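/- arXiv:1410.0457 — 3 statements merged into one kernel-verified Lean document; each statement's English description precedes it below -/
import Mathlib

section
/- Let G be a countable group and μ a probability measure on G with finite entropy H(μ). Let (Ω,θ) be a Lebesgue probability space and let τ be a randomized Markov stopping time for the random walk (G,μ), finite almost everywhere, with finite expectation E(τ). Then the asymptotic entropies satisfy h(μ_τ) = E(τ)·h(μ). -/
open MeasureTheory Filter Real Topology ENNReal

/-- Position of the random walk after `n` steps: `x n = h 1 ⋯ h n`, where `h : ℕ → G` is the
sequence of increments (`h i` being the `(i+1)`-st increment); `x 0 = e`. -/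
def rwPos {G : Type*} [Group G] (h : ℕ → G) (n : ℕ) : G :=
  ((List.range n).map h).prod

/-- Convolution of two (sub-probability) densities on `G`: `(f * g)(x) = ∑_h f(h) g(h⁻¹ x)`. -/
noncomputable def fconv {G : Type*} [Group G] (f g : G → ℝ≥0∞) : G → ℝ≥0∞ :=
  fun x => ∑' h : G, f h * g (h⁻¹ * x)

open scoped Classical in
/-- `n`-fold convolution power of a density, with `f^{*0} = δ_e`. -/
noncomputable def fconvPow {G : Type*} [Group G] (f : G → ℝ≥0∞) : ℕ → G → ℝ≥0∞
  | 0 => fun x => if x = 1 then 1 else 0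
  | n + 1 => fconv (fconvPow f n) f

/-- Entropy of a (sub-)probability density on a countable group:
`H(f) = -∑_g f(g) log f(g)`. -/
noncomputable def fent {G : Type*} (f : G → ℝ≥0∞) : ℝ :=
  -∑' g : G, (f g).toReal * Real.log (f g).toReal

/-- The σ-algebra generated by the extended chain `(x 0, ω 0), …, (x s, ω s)` up to time `s`,
on the space of pairs (increment sequence, randomization sequence). -/
def rposSigma (G Ω : Type*) [Group G] [MeasurableSpace G] [MeasurableSpace Ω] (s : ℕ) :
    MeasurableSpace ((ℕ → G) × (ℕ → Ω)) :=
  MeasurableSpace.comap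
    (fun p => ((fun i : Fin (s + 1) => rwPos p.1 (i : ℕ)), (fun i : Fin (s + 1) => p.2 i)))
    inferInstance

/-- A randomized Markov stopping time for the random walk: for every `s`, the set `{τ = s}` is
measurable with respect to the σ-algebra generated by the extended chain up to time `s`. -/
def IsRMST {G Ω : Type*} [Group G] [MeasurableSpace G] [MeasurableSpace Ω]
    (τ : (ℕ → G) × (ℕ → Ω) → ℕ) : Prop :=
  ∀ s : ℕ, MeasurableSet[rposSigma G Ω s] {p | τ p = s}

namespace StoppedWalk

/-- The surprisal `-log p`, with the value `∞` at `p = 0`. -/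
noncomputable def surprisal (p : ℝ≥0∞) : ℝ≥0∞ :=
  if p = 0 then ⊤ else ENNReal.ofReal (-Real.log p.toReal)

/-- The expectation of an extended nonnegative function. -/
noncomputable def expect {X : Type*} (κ : PMF X) (φ : X → ℝ≥0∞) : ℝ≥0∞ := ∑' x, κ x * φ x

/-- The Shannon entropy with values in `[0, ∞]`. -/
noncomputable def entropy {X : Type*} (κ : PMF X) : ℝ≥0∞ := expect κ fun x => surprisal (κ x)

section Surprisal

lemma surprisal_one : surprisal 1 = 0 := by simp [surprisal]

lemma surprisal_anti {p q : ℝ≥0∞} (h : p ≤ q) : surprisal q ≤ surprisal p := by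
  unfold surprisal
  by_cases hp : p = 0
  · simp [hp]
  by_cases hq : q = ⊤
  · simp [hq]
  have hq0 : q ≠ 0 := fun h0 => hp (le_antisymm (h0 ▸ h) bot_le)
  have hp' : p ≠ ⊤ := ne_top_of_le_ne_top hq h
  rw [if_neg hp, if_neg hq0]
  apply ENNReal.ofReal_le_ofReal
  have := Real.log_le_log (ENNReal.toReal_pos hp hp') (ENNReal.toReal_mono hq h)
  linarith

lemma surprisal_mul_le (p q : ℝ≥0∞) : surprisal (p * q) ≤ surprisal p + surprisal q := by
  unfold surprisal
  by_cases hp : p = 0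
  · simp [hp]
  by_cases hq : q = 0
  · simp [hq]
  have hpq : p * q ≠ 0 := mul_ne_zero hp hq
  by_cases hp' : p = ⊤
  · simp [hp', ENNReal.top_mul hq]
  by_cases hq' : q = ⊤
  · simp [hq', ENNReal.mul_top hp]
  rw [if_neg hp, if_neg hq, if_neg hpq, ENNReal.toReal_mul,
    Real.log_mul (ENNReal.toReal_pos hp hp').ne' (ENNReal.toReal_pos hq hq').ne', neg_add]
  exact ENNReal.ofReal_add_le

lemma mul_surprisal_add_le {f r : ℝ≥0∞} (hf : f ≤ 1) (hr : r ≠ ⊤) :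
    f * surprisal f + f ≤ f * surprisal r + r := by
  by_cases hf0 : f = 0
  · simp [hf0]
  by_cases hr0 : r = 0
  · simp [hr0, surprisal, ENNReal.mul_top hf0]
  have hft : f ≠ ⊤ := ne_top_of_le_ne_top ENNReal.one_ne_top hf
  have hfp := ENNReal.toReal_pos hf0 hft
  have hrp := ENNReal.toReal_pos hr0 hr
  rw [surprisal, surprisal, if_neg hf0, if_neg hr0]
  have e1 : f * ENNReal.ofReal (-Real.log f.toReal) + f
      = ENNReal.ofReal (f.toReal * (-Real.log f.toReal) + f.toReal) := by
    have : 0 ≤ -Real.log f.toReal := by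
      have := Real.log_nonpos hfp.le (ENNReal.toReal_mono ENNReal.one_ne_top hf)
      linarith
    rw [ENNReal.ofReal_add (by positivity) hfp.le, ENNReal.ofReal_mul hfp.le,
      ENNReal.ofReal_toReal hft]
  have e2 : ENNReal.ofReal (f.toReal * (-Real.log r.toReal) + r.toReal)
      ≤ f * ENNReal.ofReal (-Real.log r.toReal) + r := by
    refine ENNReal.ofReal_add_le.trans ?_
    rw [ENNReal.ofReal_mul hfp.le, ENNReal.ofReal_toReal hft, ENNReal.ofReal_toReal hr]
  rw [e1]
  refine le_trans (ENNReal.ofReal_le_ofReal ?_) e2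
  have h1 := Real.log_le_sub_one_of_pos (div_pos hrp hfp)
  rw [Real.log_div hrp.ne' hfp.ne'] at h1
  have h2 := mul_le_mul_of_nonneg_left h1 hfp.le
  have h3 : f.toReal * (r.toReal / f.toReal - 1) = r.toReal - f.toReal := by
    field_simp
  rw [h3] at h2
  linarith

lemma mul_surprisal_ne_top {p : ℝ≥0∞} (hp : p ≠ ⊤) : p * surprisal p ≠ ⊤ := by
  by_cases h : p = 0
  · simp [h]
  · rw [surprisal, if_neg h]
    exact ENNReal.mul_ne_top hp ENNReal.ofReal_ne_top

lemma toReal_mul_surprisal {p : ℝ≥0∞} (hp : p ≤ 1) :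
    (p * surprisal p).toReal = -(p.toReal * Real.log p.toReal) := by
  by_cases h : p = 0
  · simp [h]
  · have := Real.log_nonpos ENNReal.toReal_nonneg (ENNReal.toReal_mono ENNReal.one_ne_top hp)
    rw [surprisal, if_neg h, ENNReal.toReal_mul, ENNReal.toReal_ofReal (by linarith)]
    ring

end Surprisal

section Expect

variable {X Y : Type*}

lemma expect_pure (a : X) (φ : X → ℝ≥0∞) : expect (PMF.pure a) φ = φ a := by
  classical
  simp [expect, PMF.pure_apply]

lemma expect_bind (κ : PMF X) (η : X → PMF Y) (φ : Y → ℝ≥0∞) :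
    expect (κ.bind η) φ = expect κ fun x => expect (η x) φ := by
  simp only [expect, PMF.bind_apply, ← ENNReal.tsum_mul_right, ← ENNReal.tsum_mul_left]
  rw [ENNReal.tsum_comm]
  simp only [mul_assoc]

lemma expect_map (κ : PMF X) (f : X → Y) (φ : Y → ℝ≥0∞) :
    expect (κ.map f) φ = expect κ fun x => φ (f x) := by
  rw [PMF.map, expect_bind]
  simp [expect_pure]

lemma expect_mono {κ : PMF X} {φ ψ : X → ℝ≥0∞} (h : ∀ x, φ x ≤ ψ x) :
    expect κ φ ≤ expect κ ψ :=
  ENNReal.tsum_le_tsum fun x => mul_le_mul_right (h x) _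

lemma expect_add (κ : PMF X) (φ ψ : X → ℝ≥0∞) :
    (expect κ fun x => φ x + ψ x) = expect κ φ + expect κ ψ := by
  simp only [expect, mul_add]
  exact ENNReal.tsum_add

lemma expect_mul_const (κ : PMF X) (φ : X → ℝ≥0∞) (c : ℝ≥0∞) :
    (expect κ fun x => φ x * c) = expect κ φ * c := by
  simp only [expect, ← mul_assoc, ENNReal.tsum_mul_right]

lemma expect_const (κ : PMF X) (c : ℝ≥0∞) : (expect κ fun _ => c) = c := by
  simp only [expect, ENNReal.tsum_mul_right, PMF.tsum_coe, one_mul]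

lemma apply_le_map_apply (κ : PMF X) (f : X → Y) (x : X) : κ x ≤ κ.map f (f x) := by
  classical
  rw [PMF.map_apply]
  exact le_trans (by simp) (ENNReal.le_tsum x)

/-- Gibbs' inequality. -/
lemma entropy_le_expect_surprisal (κ : PMF X) {r : X → ℝ≥0∞} (hr : ∑' x, r x ≤ 1) :
    entropy κ ≤ expect κ fun x => surprisal (r x) := by
  have hr' : ∀ x, r x ≠ ⊤ := fun x =>
    ne_top_of_le_ne_top ENNReal.one_ne_top ((ENNReal.le_tsum x).trans hr)
  have h : entropy κ + 1 ≤ (expect κ fun x => surprisal (r x)) + 1 := by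
    calc entropy κ + 1 = ∑' x, (κ x * surprisal (κ x) + κ x) := by
          rw [ENNReal.tsum_add, PMF.tsum_coe]; rfl
      _ ≤ ∑' x, (κ x * surprisal (r x) + r x) :=
          ENNReal.tsum_le_tsum fun x => mul_surprisal_add_le (κ.coe_le_one x) (hr' x)
      _ ≤ _ := by
          rw [ENNReal.tsum_add]
          exact add_le_add le_rfl hr
  exact (ENNReal.add_le_add_iff_right ENNReal.one_ne_top).1 h

end Expect

section Coupling

variable {G X : Type*} [Group G]

lemma tsum_fconv (f g : G → ℝ≥0∞) : ∑' x, fconv f g x = (∑' x, f x) * ∑' x, g x := by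
  simp only [fconv]
  rw [ENNReal.tsum_comm, ← ENNReal.tsum_mul_right]
  refine tsum_congr fun h => ?_
  rw [ENNReal.tsum_mul_left]
  congr 1
  exact (Equiv.mulLeft h⁻¹).tsum_eq g

lemma mul_le_fconv (f g : G → ℝ≥0∞) (a b : G) : f a * g (a⁻¹ * b) ≤ fconv f g b :=
  ENNReal.le_tsum (f := fun h => f h * g (h⁻¹ * b)) a

/-- The entropies of two coupled random elements differ by at most the cost of encoding their
quotient. -/
lemma entropy_map_le (κ : PMF X) (A B : X → G) {q : G → ℝ≥0∞} (hq : ∑' g, q g ≤ 1) :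
    entropy (κ.map B) ≤
      entropy (κ.map A) + expect κ fun x => surprisal (q ((A x)⁻¹ * B x)) := by
  have hr : ∑' x, fconv (κ.map A) q x ≤ 1 := by
    rw [tsum_fconv, PMF.tsum_coe, one_mul]; exact hq
  refine (entropy_le_expect_surprisal _ hr).trans ?_
  rw [entropy, expect_map, expect_map, ← expect_add]
  exact expect_mono fun x => (surprisal_anti (mul_le_fconv _ _ _ _)).trans (surprisal_mul_le _ _)

end Coupling

end StoppedWalk
namespace StoppedWalk

section Words

variable {G : Type*}

/-- The law of the concatenation of `n` independent `ν`-distributed words. -/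
noncomputable def wordPow (ν : PMF (List G)) : ℕ → PMF (List G)
  | 0 => PMF.pure []
  | n + 1 => (wordPow ν n).bind fun w => ν.map fun v => w ++ v

/-- The law of a word of `n` independent `μ`-distributed letters. -/
noncomputable def iidWord (μ : PMF G) (n : ℕ) : PMF (List G) := wordPow (μ.map fun a => [a]) n

lemma wordPow_one (ν : PMF (List G)) : wordPow ν 1 = ν := by
  simp only [wordPow, PMF.pure_bind, List.nil_append]
  exact PMF.map_id _

lemma wordPow_add (ν : PMF (List G)) (n k : ℕ) :
    wordPow ν (n + k) = (wordPow ν n).bind fun w => (wordPow ν k).map fun v => w ++ v := by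
  induction k with
  | zero => simp [wordPow, PMF.pure_map]
  | succ k ih =>
    rw [← add_assoc, wordPow, ih, wordPow]
    simp only [PMF.bind_bind, PMF.map_bind, PMF.bind_map, PMF.map_comp, Function.comp_def,
      List.append_assoc]

/-- A law on words is compatible with `μ` if a word drawn from it, truncated at length `m` and
completed up to length `m` by independent `μ`-distributed letters, is a word of `m` independent
`μ`-distributed letters. -/
def Compatible (μ : PMF G) (ν : PMF (List G)) : Prop :=
  ∀ m : ℕ, (ν.bind fun w => (iidWord μ (m - w.length)).map fun u => w.take m ++ u) = iidWord μ m

lemma Compatible.pow {μ : PMF G} {ν : PMF (List G)} (hν : Compatible μ ν) (n : ℕ) :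
    Compatible μ (wordPow ν n) := by
  induction n with
  | zero =>
    intro m
    simp only [wordPow, PMF.pure_bind, List.length_nil, Nat.sub_zero, List.take_nil,
      List.nil_append]
    exact PMF.map_id _
  | succ n ih =>
    intro m
    rw [← ih m, wordPow, PMF.bind_bind]
    congr 1
    funext w
    rw [← hν (m - w.length)]
    simp only [PMF.bind_map, PMF.map_bind, PMF.map_comp, Function.comp_def, List.length_append,
      List.take_append, List.append_assoc, Nat.sub_sub]

lemma iidWord_apply [DecidableEq G] (μ : PMF G) (n : ℕ) (z : List G) :
    iidWord μ n z = if z.length = n then (z.map μ).prod else 0 := by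
  induction n generalizing z with
  | zero =>
    simp only [iidWord, wordPow, PMF.pure_apply, List.length_eq_zero_iff]
    split_ifs with h
    · simp [h]
    · rfl
  | succ n ih =>
    have hrec : iidWord μ (n + 1) z
        = ∑' w : List G, iidWord μ n w * ∑' a : G, if z = w ++ [a] then μ a else 0 := by
      simp only [iidWord, wordPow, PMF.bind_apply, PMF.map_comp, PMF.map_apply,
        Function.comp_def]
      refine tsum_congr fun w => ?_
      congr 1
      exact tsum_congr fun a => by congr
    rw [hrec]
    rcases List.eq_nil_or_concat z with rfl | ⟨z, b, rfl⟩
    · simp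
    · rw [tsum_eq_single z, tsum_eq_single b]
      · simp [ih]
      · intro a ha
        rw [if_neg]
        intro h
        exact ha (by simpa using h.symm)
      · intro w hw
        have : ∀ a, ¬ (z ++ [b] = w ++ [a]) := fun a h =>
          hw (List.append_inj_left' h rfl).symm
        simp [this]

end Words

section Additive

variable {G : Type*} {φ : List G → ℝ≥0∞}

lemma expect_wordPow (hnil : φ [] = 0) (happ : ∀ u v, φ (u ++ v) = φ u + φ v)
    (ν : PMF (List G)) (n : ℕ) : expect (wordPow ν n) φ = n * expect ν φ := by
  induction n with
  | zero => simp [wordPow, expect_pure, hnil]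
  | succ n ih =>
    rw [wordPow, expect_bind]
    simp only [expect_map, happ, expect_add, expect_const]
    rw [ih]
    push_cast
    ring

lemma expect_iidWord (hnil : φ [] = 0) (happ : ∀ u v, φ (u ++ v) = φ u + φ v)
    (μ : PMF G) (n : ℕ) : expect (iidWord μ n) φ = n * expect μ fun a => φ [a] := by
  rw [iidWord, expect_wordPow hnil happ, expect_map]

lemma length_eq (m n : ℕ) :
    (m : ℝ≥0∞) = (min m n : ℕ) + (m - n : ℕ) := by
  norm_cast
  omega

variable {μ : PMF G} {ν : PMF (List G)}

lemma Compatible.expect_take (hν : Compatible μ ν) (hnil : φ [] = 0)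
    (happ : ∀ u v, φ (u ++ v) = φ u + φ v) (hφ : (expect μ fun a => φ [a]) ≠ ⊤) (m : ℕ) :
    (expect ν fun w => φ (w.take m))
      = (expect ν fun w => (min m w.length : ℕ)) * expect μ fun a => φ [a] := by
  set H := expect μ fun a => φ [a]
  have h1 : (expect ν fun w => φ (w.take m)) + (expect ν fun w => (m - w.length : ℕ)) * H
      = m * H := by
    rw [← expect_iidWord hnil happ μ m, ← hν m, expect_bind, ← expect_mul_const, ← expect_add]
    congr 1
    funext w
    simp only [expect_map, happ, expect_add, expect_const]
    rw [expect_iidWord hnil happ]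
  have h2 : (expect ν fun w => (min m w.length : ℕ)) * H
      + (expect ν fun w => (m - w.length : ℕ)) * H = m * H := by
    rw [← add_mul, ← expect_add]
    simp only [← length_eq, expect_const]
  have h3 : (expect ν fun w => ((m - w.length : ℕ) : ℝ≥0∞)) * H ≠ ⊤ := by
    refine ENNReal.mul_ne_top (ne_top_of_le_ne_top (ENNReal.natCast_ne_top m) ?_) hφ
    refine (expect_mono fun w => ?_).trans (expect_const ν _).le
    exact_mod_cast Nat.sub_le _ _
  exact (ENNReal.add_left_inj h3).1 (h1.trans h2.symm)

/-- The upper bound in Wald's identity. -/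
lemma Compatible.expect_le (hν : Compatible μ ν) (hnil : φ [] = 0)
    (happ : ∀ u v, φ (u ++ v) = φ u + φ v) (hφ : (expect μ fun a => φ [a]) ≠ ⊤) :
    expect ν φ ≤ (expect ν fun w => (w.length : ℝ≥0∞)) * expect μ fun a => φ [a] := by
  rw [expect, ENNReal.tsum_eq_iSup_sum]
  refine iSup_le fun s => ?_
  set M := s.sup List.length
  calc ∑ w ∈ s, ν w * φ w = ∑ w ∈ s, ν w * φ (w.take M) := by
        refine Finset.sum_congr rfl fun w hw => ?_
        rw [List.take_of_length_le (Finset.le_sup (f := List.length) hw)]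
    _ ≤ expect ν fun w => φ (w.take M) := ENNReal.sum_le_tsum s
    _ = (expect ν fun w => (min M w.length : ℕ)) * expect μ fun a => φ [a] :=
        hν.expect_take hnil happ hφ M
    _ ≤ _ := by
        gcongr
        exact expect_mono fun w => by exact_mod_cast min_le_right _ _

lemma Compatible.expect_drop_le (hν : Compatible μ ν) (hnil : φ [] = 0)
    (happ : ∀ u v, φ (u ++ v) = φ u + φ v) (hφ : (expect μ fun a => φ [a]) ≠ ⊤) (m : ℕ) :
    (expect ν fun w => φ (w.drop m))
      ≤ (expect ν fun w => (w.length - m : ℕ)) * expect μ fun a => φ [a] := by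
  set H := expect μ fun a => φ [a]
  have h1 : (expect ν fun w => (min m w.length : ℕ)) * H + (expect ν fun w => φ (w.drop m))
      ≤ (expect ν fun w => (min m w.length : ℕ)) * H
        + (expect ν fun w => (w.length - m : ℕ)) * H := by
    rw [← hν.expect_take hnil happ hφ m, ← expect_add, hν.expect_take hnil happ hφ m, ← add_mul,
      ← expect_add]
    simp only [← happ, List.take_append_drop]
    convert hν.expect_le hnil happ hφ using 3
    funext w
    rw [min_comm, ← length_eq]
  have h3 : (expect ν fun w => ((min m w.length : ℕ) : ℝ≥0∞)) * H ≠ ⊤ := by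
    refine ENNReal.mul_ne_top (ne_top_of_le_ne_top (ENNReal.natCast_ne_top m) ?_) hφ
    refine (expect_mono fun w => ?_).trans (expect_const ν _).le
    exact_mod_cast min_le_left _ _
  exact (ENNReal.add_le_add_iff_left h3).1 h1

end Additive

section Coding

variable {G : Type*}

/-- The total surprisal of the letters of a word. -/
noncomputable def wordSurprisal (μ : PMF G) (z : List G) : ℝ≥0∞ :=
  (z.map fun a => surprisal (μ a)).sum

/-- An upper bound for the cost of encoding the product of a word of unknown length. -/
noncomputable def codeCost (μ : PMF G) (z : List G) : ℝ≥0∞ :=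
  (z.length * surprisal 2⁻¹ + wordSurprisal μ z) + surprisal 2⁻¹

lemma surprisal_pow_le (p : ℝ≥0∞) (n : ℕ) : surprisal (p ^ n) ≤ n * surprisal p := by
  induction n with
  | zero => simp [surprisal_one]
  | succ n ih =>
    rw [pow_succ]
    refine (surprisal_mul_le _ _).trans ?_
    push_cast
    rw [add_mul, one_mul]
    gcongr

lemma surprisal_iidWord_le (μ : PMF G) (z : List G) :
    surprisal (iidWord μ z.length z) ≤ wordSurprisal μ z := by
  classical
  rw [iidWord_apply, if_pos rfl, wordSurprisal]
  induction z with
  | nil => simp [surprisal_one]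
  | cons a z ih =>
    simp only [List.map_cons, List.prod_cons, List.sum_cons]
    exact (surprisal_mul_le _ _).trans (by gcongr)

variable [Group G]

/-- The mixture, with geometric weights, of the convolution powers of `μ`. -/
noncomputable def geomMix (μ : PMF G) (g : G) : ℝ≥0∞ :=
  ∑' l : ℕ, 2⁻¹ ^ (l + 1) * (iidWord μ l).map List.prod g

lemma tsum_geomMix (μ : PMF G) : ∑' g, geomMix μ g = 1 := by
  simp only [geomMix]
  rw [ENNReal.tsum_comm]
  simp only [ENNReal.tsum_mul_left, PMF.tsum_coe, mul_one]
  rw [ENNReal.tsum_geometric_add_one, ENNReal.one_sub_inv_two, inv_inv,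
    ENNReal.inv_mul_cancel two_ne_zero ENNReal.ofNat_ne_top]

lemma surprisal_geomMix_le (μ : PMF G) (z : List G) :
    surprisal (geomMix μ z.prod) ≤ codeCost μ z := by
  have h : 2⁻¹ ^ (z.length + 1) * iidWord μ z.length z ≤ geomMix μ z.prod :=
    (mul_le_mul_right (apply_le_map_apply _ _ _) _).trans
      (ENNReal.le_tsum (f := fun l : ℕ => 2⁻¹ ^ (l + 1) * (iidWord μ l).map List.prod z.prod)
        z.length)
  refine (surprisal_anti h).trans ((surprisal_mul_le _ _).trans ?_)
  refine (add_le_add (surprisal_pow_le _ _) (surprisal_iidWord_le μ z)).trans (le_of_eq ?_)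
  rw [codeCost]
  push_cast
  ring

lemma surprisal_two_inv_ne_top : surprisal 2⁻¹ ≠ ⊤ := by
  simp [surprisal]

lemma entropy_map_le_of_mul_eq {X : Type*} (κ : PMF X) (μ : PMF G) (A B : X → G)
    (z : X → List G) (h : ∀ x, A x * (z x).prod = B x) :
    entropy (κ.map B) ≤ entropy (κ.map A) + (expect κ fun x => codeCost μ (z x)) ∧
      entropy (κ.map A) ≤ entropy (κ.map B) + (expect κ fun x => codeCost μ (z x)) := by
  constructor
  · refine (entropy_map_le κ A B (tsum_geomMix μ).le).trans ?_
    gcongr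
    refine expect_mono fun x => ?_
    rw [← h x, inv_mul_cancel_left]
    exact surprisal_geomMix_le μ _
  · have hq : ∑' g, geomMix μ g⁻¹ ≤ 1 :=
      ((Equiv.inv G).tsum_eq (geomMix μ)).le.trans (tsum_geomMix μ).le
    refine (entropy_map_le κ B A hq).trans ?_
    gcongr
    refine expect_mono fun x => ?_
    rw [← h x, mul_inv_rev, inv_inv, inv_mul_cancel_left]
    exact surprisal_geomMix_le μ _

variable {μ : PMF G} {ν : PMF (List G)}

/-- The cost of comparing the walk stopped at a random time with the walk at time `m`. -/
noncomputable def gapCost (μ : PMF G) (ν : PMF (List G)) (m : ℕ) : ℝ≥0∞ :=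
  (expect ν fun w => ((w.length - m : ℕ) : ℝ≥0∞) + (m - w.length : ℕ))
    * (surprisal 2⁻¹ + entropy μ) + 2 * surprisal 2⁻¹

lemma Compatible.entropy_comparison (hν : Compatible μ ν) (hμ : entropy μ ≠ ⊤) (m : ℕ) :
    entropy (ν.map List.prod) ≤ entropy ((iidWord μ m).map List.prod) + gapCost μ ν m ∧
      entropy ((iidWord μ m).map List.prod) ≤ entropy (ν.map List.prod) + gapCost μ ν m := by
  set φ : List G → ℝ≥0∞ := fun z => z.length * surprisal 2⁻¹ + wordSurprisal μ z with hφ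
  have hnil : φ [] = 0 := by simp [hφ, wordSurprisal]
  have happ : ∀ u v, φ (u ++ v) = φ u + φ v := fun u v => by
    simp only [hφ, wordSurprisal, List.length_append, List.map_append, List.sum_append,
      Nat.cast_add]
    ring
  have hone : (expect μ fun a => φ [a]) = surprisal 2⁻¹ + entropy μ := by
    simp only [hφ, wordSurprisal, List.length_singleton, List.map_singleton, List.sum_singleton,
      Nat.cast_one, one_mul, expect_add, expect_const]
    rfl
  have hfin : (expect μ fun a => φ [a]) ≠ ⊤ := by
    rw [hone]
    exact ENNReal.add_ne_top.2 ⟨surprisal_two_inv_ne_top, hμ⟩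
  set κ : PMF (List G × List G) :=
    ν.bind fun w => (iidWord μ (m - w.length)).map fun u => (w, u)
  obtain ⟨h1, h2⟩ := entropy_map_le_of_mul_eq κ μ (fun x => (x.1.take m).prod)
    (fun x => x.1.prod) (fun x => x.1.drop m)
    (fun x => by rw [← List.prod_append, List.take_append_drop])
  obtain ⟨h3, h4⟩ := entropy_map_le_of_mul_eq κ μ (fun x => (x.1.take m).prod)
    (fun x => (x.1.take m ++ x.2).prod) (fun x => x.2) (fun x => List.prod_append.symm)
  have hB : κ.map (fun x => x.1.prod) = ν.map List.prod := by
    simp only [κ, PMF.map_bind, PMF.map_comp, Function.comp_def]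
    simp only [PMF.map, Function.comp_def, PMF.bind_const]
  have hA : κ.map (fun x => (x.1.take m ++ x.2).prod) = (iidWord μ m).map List.prod := by
    rw [← hν m]
    simp only [κ, PMF.map_bind, PMF.map_comp, Function.comp_def]
  have hdrop : (expect κ fun x => codeCost μ (x.1.drop m))
      ≤ (expect ν fun w => ((w.length - m : ℕ) : ℝ≥0∞)) * (surprisal 2⁻¹ + entropy μ)
        + surprisal 2⁻¹ := by
    simp only [κ, expect_bind, expect_map, expect_const, codeCost]
    rw [expect_add, expect_const, ← hone]
    gcongr
    exact hν.expect_drop_le hnil happ hfin m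
  have hfresh : (expect κ fun x => codeCost μ x.2)
      = (expect ν fun w => ((m - w.length : ℕ) : ℝ≥0∞)) * (surprisal 2⁻¹ + entropy μ)
        + surprisal 2⁻¹ := by
    have hiid : ∀ n : ℕ, (expect (iidWord μ n) fun u => codeCost μ u)
        = n * (surprisal 2⁻¹ + entropy μ) + surprisal 2⁻¹ := fun n => by
      simp only [codeCost]
      rw [expect_add, expect_const, expect_iidWord hnil happ, hone]
    simp only [κ, expect_bind, expect_map, hiid]
    rw [expect_add, expect_const, expect_mul_const]
  have hgap : (expect κ fun x => codeCost μ (x.1.drop m)) + (expect κ fun x => codeCost μ x.2)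
      ≤ gapCost μ ν m := by
    refine (add_le_add hdrop hfresh.le).trans (le_of_eq ?_)
    rw [gapCost, expect_add]
    ring
  rw [hB] at h1 h2
  rw [hA] at h3 h4
  constructor
  · refine (h1.trans (add_le_add h4 le_rfl)).trans ?_
    rw [add_assoc, add_comm (expect κ _)]
    gcongr
  · refine (h3.trans (add_le_add h2 le_rfl)).trans ?_
    rw [add_assoc]
    gcongr

end Coding

end StoppedWalk
namespace StoppedWalk

section Convolution

variable {G : Type*} [Group G]

lemma fconv_eq_bind (p q : PMF G) :
    fconv (⇑p) (⇑q) = ⇑(p.bind fun a => q.map fun b => a * b) := by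
  classical
  funext x
  simp only [fconv, PMF.bind_apply, PMF.map_apply]
  refine tsum_congr fun a => ?_
  congr 1
  rw [tsum_eq_single (a⁻¹ * x)]
  · simp
  · intro b hb
    rw [if_neg]
    rintro rfl
    simp at hb

lemma fconvPow_map_prod (ν : PMF (List G)) (n : ℕ) :
    fconvPow (⇑(ν.map List.prod)) n = ⇑((wordPow ν n).map List.prod) := by
  classical
  induction n with
  | zero =>
    funext x
    simp only [fconvPow, wordPow, PMF.pure_map, List.prod_nil, PMF.pure_apply]
  | succ n ih =>
    rw [fconvPow, ih, fconv_eq_bind, wordPow]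
    simp only [PMF.map_bind, PMF.bind_map, PMF.map_comp, Function.comp_def, List.prod_append]

lemma fent_eq_toReal_entropy {X : Type*} (κ : PMF X) : fent (⇑κ) = (entropy κ).toReal := by
  rw [fent, entropy, expect,
    ENNReal.tsum_toReal_eq fun x => mul_surprisal_ne_top (κ.apply_ne_top x), ← tsum_neg]
  exact tsum_congr fun x => (toReal_mul_surprisal (κ.coe_le_one x)).symm

lemma entropy_ne_top_of_summable {X : Type*} {κ : PMF X}
    (h : Summable fun x => (κ x).toReal * Real.log (κ x).toReal) : entropy κ ≠ ⊤ := by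
  have h' : Summable fun x => (κ x * surprisal (κ x)).toReal := by
    simpa only [toReal_mul_surprisal (κ.coe_le_one _)] using h.neg
  have := h'.tsum_ofReal_ne_top
  rw [entropy, expect]
  simpa only [ENNReal.ofReal_toReal (mul_surprisal_ne_top (κ.apply_ne_top _))] using this

lemma entropy_map_prod_wordPow_add_le (ν : PMF (List G)) (n k : ℕ) :
    entropy ((wordPow ν (n + k)).map List.prod)
      ≤ entropy ((wordPow ν n).map List.prod) + entropy ((wordPow ν k).map List.prod) := by
  set κ : PMF (List G × List G) :=
    (wordPow ν n).bind fun w => (wordPow ν k).map fun v => (w, v)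
  have h := entropy_map_le κ (fun x => x.1.prod) (fun x => x.1.prod * x.2.prod)
    (q := (wordPow ν k).map List.prod) (PMF.tsum_coe _).le
  have hB : κ.map (fun x => x.1.prod * x.2.prod) = (wordPow ν (n + k)).map List.prod := by
    rw [wordPow_add]
    simp only [κ, PMF.map_bind, PMF.map_comp, Function.comp_def, List.prod_append]
  have hA : κ.map (fun x => x.1.prod) = (wordPow ν n).map List.prod := by
    simp only [κ, PMF.map_bind, PMF.map_comp, Function.comp_def]
    simp only [PMF.map, Function.comp_def, PMF.bind_const]
  rw [hA, hB] at h
  refine h.trans (add_le_add le_rfl (le_of_eq ?_))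
  simp only [κ, expect_bind, expect_map, inv_mul_cancel_left, expect_const]
  rw [entropy, expect_map]

lemma entropy_map_prod_zero (ν : PMF (List G)) : entropy ((wordPow ν 0).map List.prod) = 0 := by
  rw [wordPow, PMF.pure_map, entropy, expect_pure, PMF.pure_apply_self, surprisal_one]

lemma entropy_map_prod_wordPow_ne_top {ν : PMF (List G)} (h : entropy (ν.map List.prod) ≠ ⊤)
    (n : ℕ) : entropy ((wordPow ν n).map List.prod) ≠ ⊤ := by
  induction n with
  | zero => simp [entropy_map_prod_zero]
  | succ n ih =>
    refine ne_top_of_le_ne_top (ENNReal.add_ne_top.2 ⟨ih, h⟩)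
      ((entropy_map_prod_wordPow_add_le ν n 1).trans (le_of_eq ?_))
    rw [wordPow_one]

/-- Existence of the asymptotic entropy. -/
lemma exists_tendsto_entropy_div {ν : PMF (List G)} (h : entropy (ν.map List.prod) ≠ ⊤) :
    ∃ l : ℝ, Tendsto (fun n : ℕ => (entropy ((wordPow ν n).map List.prod)).toReal / n) atTop
      (𝓝 l) := by
  have hsub : Subadditive fun n : ℕ => (entropy ((wordPow ν n).map List.prod)).toReal := by
    intro n k
    have h1 := entropy_map_prod_wordPow_ne_top h n
    have h2 := entropy_map_prod_wordPow_ne_top h k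
    rw [← ENNReal.toReal_add h1 h2]
    exact ENNReal.toReal_mono (ENNReal.add_ne_top.2 ⟨h1, h2⟩)
      (entropy_map_prod_wordPow_add_le ν n k)
  refine ⟨hsub.lim, hsub.tendsto_lim ⟨0, ?_⟩⟩
  rintro _ ⟨n, rfl⟩
  positivity

end Convolution

section LawOfLargeNumbers

open ProbabilityTheory

variable {G : Type*}

lemma lintegral_toMeasure {X : Type*} [Countable X] [MeasurableSpace X]
    [MeasurableSingletonClass X] (κ : PMF X) (φ : X → ℝ≥0∞) :
    ∫⁻ x, φ x ∂κ.toMeasure = expect κ φ := by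
  rw [lintegral_countable']
  refine tsum_congr fun x => ?_
  rw [PMF.toMeasure_apply_singleton _ _ (measurableSet_singleton x), mul_comm]

/-- The law of a sequence of independent copies of the length of a `ν`-distributed word. -/
noncomputable def lengthsLaw (ν : PMF (List G)) : Measure (ℕ → ℕ) :=
  Measure.infinitePi fun _ => (ν.map List.length).toMeasure

instance (ν : PMF (List G)) : IsProbabilityMeasure (lengthsLaw ν) := by
  unfold lengthsLaw; infer_instance

lemma iIndepFun_lengthsLaw (ν : PMF (List G)) :
    iIndepFun (fun (i : ℕ) (ω : ℕ → ℕ) => ω i) (lengthsLaw ν) :=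
  iIndepFun_infinitePi (X := fun _ a => a) fun _ => measurable_id

lemma map_eval_lengthsLaw (ν : PMF (List G)) (i : ℕ) :
    (lengthsLaw ν).map (fun ω => ω i) = (ν.map List.length).toMeasure :=
  Measure.infinitePi_map_eval _ i

lemma expect_wordPow_length (ν : PMF (List G)) (n : ℕ) (φ : ℕ → ℝ≥0∞) :
    (expect (wordPow ν n) fun w => φ w.length)
      = ∫⁻ ω, φ (∑ i ∈ Finset.range n, ω i) ∂lengthsLaw ν := by
  induction n generalizing φ with
  | zero => simp [wordPow, expect_pure]
  | succ n ih =>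
    have hind : IndepFun (fun ω : ℕ → ℕ => ∑ i ∈ Finset.range n, ω i) (fun ω => ω n)
        (lengthsLaw ν) := by
      have := (iIndepFun_lengthsLaw ν).indepFun_sum_range_succ
        (fun i => measurable_pi_apply i) n
      convert this using 1
      funext ω
      simp
    have hS : Measurable fun ω : ℕ → ℕ => ∑ i ∈ Finset.range n, ω i := by fun_prop
    have hn : Measurable fun ω : ℕ → ℕ => ω n := measurable_pi_apply n
    have hmap := (indepFun_iff_map_prod_eq_prod_map_map hS.aemeasurable hn.aemeasurable).1 hind
    have hφ : Measurable fun x : ℕ × ℕ => φ (x.1 + x.2) := measurable_of_countable _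
    simp only [Finset.sum_range_succ]
    rw [← lintegral_map (f := fun x : ℕ × ℕ => φ (x.1 + x.2)) hφ (hS.prodMk hn), hmap,
      lintegral_prod _ hφ.aemeasurable, lintegral_map (measurable_of_countable _) hS,
      map_eval_lengthsLaw]
    simp only [lintegral_toMeasure, expect_map]
    rw [← ih fun a => expect ν fun v => φ (a + v.length), wordPow, expect_bind]
    simp only [expect_map, List.length_append]

lemma gap_le {n : ℕ} (hn : 0 < n) (S : ℕ) {t : ℝ} (ht : 0 ≤ t) :
    ((S - ⌊t * n⌋₊ : ℕ) : ℝ≥0∞) + (⌊t * n⌋₊ - S : ℕ) ≤ n * ‖(n : ℝ)⁻¹ • (S : ℝ) - t‖ₑ + 1 := by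
  set m := ⌊t * n⌋₊
  have hn' : (0 : ℝ) < n := by exact_mod_cast hn
  have h1 : (m : ℝ) ≤ t * n := Nat.floor_le (by positivity)
  have h2 : t * n < m + 1 := Nat.lt_floor_add_one _
  have e1 : ((S - m : ℕ) : ℝ≥0∞) + (m - S : ℕ) = ENNReal.ofReal ((S - m : ℕ) + (m - S : ℕ)) := by
    rw [ENNReal.ofReal_add (by positivity) (by positivity)]
    simp
  have e2 : (n : ℝ≥0∞) * ‖(n : ℝ)⁻¹ • (S : ℝ) - t‖ₑ + 1 = ENNReal.ofReal (|S - t * n| + 1) := by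
    rw [Real.enorm_eq_ofReal_abs, ← ENNReal.ofReal_natCast, ← ENNReal.ofReal_mul hn'.le,
      ENNReal.ofReal_add (by positivity) zero_le_one, ENNReal.ofReal_one]
    congr 2
    rw [smul_eq_mul, ← abs_of_pos hn', ← abs_mul, abs_of_pos hn']
    congr 1
    field_simp
  rw [e1, e2]
  apply ENNReal.ofReal_le_ofReal
  rcases le_total S m with h | h
  · rw [Nat.sub_eq_zero_of_le h, Nat.cast_sub h]
    have := neg_abs_le ((S : ℝ) - t * n)
    push_cast
    linarith
  · rw [Nat.sub_eq_zero_of_le h, Nat.cast_sub h]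
    have := le_abs_self ((S : ℝ) - t * n)
    push_cast
    linarith

/-- The law of large numbers in `L¹` for the length of a product of independent words. -/
lemma tendsto_expect_gap_div (ν : PMF (List G))
    (hν : (expect ν fun w => (w.length : ℝ≥0∞)) ≠ ⊤) :
    Tendsto (fun n : ℕ => (expect (wordPow ν n) fun w =>
      ((w.length - ⌊(expect ν fun w => (w.length : ℝ≥0∞)).toReal * n⌋₊ : ℕ) : ℝ≥0∞)
        + (⌊(expect ν fun w => (w.length : ℝ≥0∞)).toReal * n⌋₊ - w.length : ℕ)) / n)
      atTop (𝓝 0) := by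
  set t := (expect ν fun w => (w.length : ℝ≥0∞)).toReal with ht
  have ht0 : 0 ≤ t := ENNReal.toReal_nonneg
  set X : ℕ → (ℕ → ℕ) → ℝ := fun i ω => (ω i : ℝ)
  have hX : ∀ i, Measurable (X i) := fun i =>
    (measurable_of_countable (fun a : ℕ => (a : ℝ))).comp (measurable_pi_apply i)
  have hlen : ∫⁻ ω, ((ω 0 : ℕ) : ℝ≥0∞) ∂lengthsLaw ν = expect ν fun w => (w.length : ℝ≥0∞) := by
    have := expect_wordPow_length ν 1 fun a => (a : ℝ≥0∞)
    rw [wordPow_one] at this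
    simpa using this.symm
  have hnorm : ∀ ω, ‖X 0 ω‖ₑ = ((ω 0 : ℕ) : ℝ≥0∞) := fun ω => by
    simp [X]
  have hint : Integrable (X 0) (lengthsLaw ν) := by
    refine ⟨(hX 0).aestronglyMeasurable, ?_⟩
    rw [HasFiniteIntegral]
    simp only [hnorm, hlen]
    exact hν.lt_top
  have hmean : ∫ ω, X 0 ω ∂lengthsLaw ν = t := by
    rw [integral_eq_lintegral_of_nonneg_ae (Eventually.of_forall fun ω => by positivity)
      (hX 0).aestronglyMeasurable, ht, ← hlen]
    simp [X]
  have hslln := strong_law_Lp le_rfl ENNReal.one_ne_top X (memLp_one_iff_integrable.2 hint)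
    (fun i j hij => ((iIndepFun_lengthsLaw ν).indepFun hij).comp
      (measurable_of_countable _) (measurable_of_countable _))
    (fun i => by
      refine IdentDistrib.comp (u := fun a : ℕ => (a : ℝ)) (f := fun ω : ℕ → ℕ => ω i)
        (g := fun ω : ℕ → ℕ => ω 0) ⟨(measurable_pi_apply i).aemeasurable,
        (measurable_pi_apply 0).aemeasurable, ?_⟩ (measurable_of_countable _)
      rw [map_eval_lengthsLaw, map_eval_lengthsLaw])
  simp only [eLpNorm_one_eq_lintegral_enorm, hmean] at hslln
  have hlim := hslln.add ENNReal.tendsto_inv_nat_nhds_zero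
  rw [add_zero] at hlim
  refine tendsto_of_tendsto_of_tendsto_of_le_of_le' tendsto_const_nhds hlim
    (Eventually.of_forall fun _ => bot_le) ?_
  filter_upwards [eventually_gt_atTop 0] with n hn
  have hn0 : (n : ℝ≥0∞) ≠ 0 := by exact_mod_cast hn.ne'
  rw [expect_wordPow_length ν n fun a => ((a - ⌊t * n⌋₊ : ℕ) : ℝ≥0∞) + (⌊t * n⌋₊ - a : ℕ)]
  refine ENNReal.div_le_of_le_mul ?_
  rw [add_mul, ENNReal.inv_mul_cancel hn0 (ENNReal.natCast_ne_top n), mul_comm _ (n : ℝ≥0∞),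
    ← lintegral_const_mul _ ?_]
  · calc _ ≤ ∫⁻ ω, (n * ‖(n : ℝ)⁻¹ • ∑ i ∈ Finset.range n, X i ω - t‖ₑ + 1) ∂lengthsLaw ν := by
          refine lintegral_mono fun ω => ?_
          simp only [X, ← Nat.cast_sum]
          exact gap_le hn _ ht0
      _ = _ := by
          rw [lintegral_add_right _ measurable_const]
          simp
  · have : Measurable fun ω => ∑ i ∈ Finset.range n, X i ω :=
      Finset.measurable_sum _ fun i _ => hX i
    fun_prop

end LawOfLargeNumbers

section Limit

variable {G : Type*} [Group G] {μ : PMF G} {ν : PMF (List G)}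

lemma map_prod_singleton (μ : PMF G) : (μ.map fun a => [a]).map List.prod = μ := by
  rw [PMF.map_comp]
  simp only [Function.comp_def, List.prod_singleton]
  exact PMF.map_id μ

lemma abs_toReal_sub_le {a b c : ℝ≥0∞} (ha : a ≠ ⊤) (hc : c ≠ ⊤) (h1 : b ≤ a + c)
    (h2 : a ≤ b + c) : |b.toReal - a.toReal| ≤ c.toReal := by
  have hb : b ≠ ⊤ := ne_top_of_le_ne_top (ENNReal.add_ne_top.2 ⟨ha, hc⟩) h1
  have h1' := ENNReal.toReal_mono (ENNReal.add_ne_top.2 ⟨ha, hc⟩) h1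
  have h2' := ENNReal.toReal_mono (ENNReal.add_ne_top.2 ⟨hb, hc⟩) h2
  rw [ENNReal.toReal_add ha hc] at h1'
  rw [ENNReal.toReal_add hb hc] at h2'
  rw [abs_le]
  constructor <;> linarith

lemma Compatible.exists_tendsto_entropy (hν : Compatible μ ν) (hμ : entropy μ ≠ ⊤)
    (hlen : (expect ν fun w => (w.length : ℝ≥0∞)) ≠ ⊤) :
    ∃ h : ℝ,
      Tendsto (fun n : ℕ => (entropy ((iidWord μ n).map List.prod)).toReal / n) atTop (𝓝 h) ∧
      Tendsto (fun n : ℕ => (entropy ((wordPow ν n).map List.prod)).toReal / n) atTop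
        (𝓝 ((expect ν fun w => (w.length : ℝ≥0∞)).toReal * h)) := by
  set t := (expect ν fun w => (w.length : ℝ≥0∞)).toReal with ht
  have ht0 : 0 ≤ t := ENNReal.toReal_nonneg
  have hμ' : entropy ((μ.map fun a => [a]).map List.prod) ≠ ⊤ := by
    rwa [map_prod_singleton]
  obtain ⟨h, hh⟩ := exists_tendsto_entropy_div hμ'
  refine ⟨h, hh, ?_⟩
  set m : ℕ → ℕ := fun n => ⌊t * n⌋₊ with hm
  set a : ℕ → ℝ := fun n => (entropy ((iidWord μ n).map List.prod)).toReal with ha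
  have hmn : Tendsto (fun n : ℕ => (m n : ℝ) / n) atTop (𝓝 t) :=
    (tendsto_nat_floor_mul_div_atTop ht0).comp tendsto_natCast_atTop_atTop
  have hwalk : Tendsto (fun n : ℕ => a (m n) / n) atTop (𝓝 (t * h)) := by
    rcases ht0.eq_or_lt with h0 | h0
    · have : ∀ n, a (m n) / n = 0 := fun n => by
        simp [ha, hm, ← h0, iidWord, entropy_map_prod_zero]
      simp [this, ← h0]
    · have hminf : Tendsto m atTop atTop :=
        tendsto_nat_floor_atTop.comp (tendsto_natCast_atTop_atTop.const_mul_atTop h0)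
      have := hmn.mul (hh.comp hminf)
      refine this.congr' ?_
      filter_upwards [hminf.eventually_gt_atTop 0] with n hn
      have : (m n : ℝ) ≠ 0 := by exact_mod_cast hn.ne'
      simp only [Function.comp, a, iidWord]
      field_simp
  have hcost : Tendsto (fun n : ℕ => gapCost μ (wordPow ν n) (m n) / n) atTop (𝓝 0) := by
    have hK : surprisal 2⁻¹ + entropy μ ≠ ⊤ :=
      ENNReal.add_ne_top.2 ⟨surprisal_two_inv_ne_top, hμ⟩
    have h1 := ENNReal.Tendsto.mul_const (tendsto_expect_gap_div ν hlen) (b := surprisal 2⁻¹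
      + entropy μ) (Or.inr hK)
    have h2 := ENNReal.Tendsto.const_mul ENNReal.tendsto_inv_nat_nhds_zero
      (a := 2 * surprisal 2⁻¹)
      (Or.inr (ENNReal.mul_ne_top ENNReal.ofNat_ne_top surprisal_two_inv_ne_top))
    have h3 := h1.add h2
    rw [zero_mul, mul_zero, add_zero] at h3
    refine h3.congr fun n => ?_
    simp only [gapCost, div_eq_mul_inv, hm, ht]
    ring
  have hdiff : Tendsto (fun n : ℕ =>
      (entropy ((wordPow ν n).map List.prod)).toReal / n - a (m n) / n) atTop (𝓝 0) := by
    have hreal := (ENNReal.tendsto_toReal ENNReal.zero_ne_top).comp hcost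
    refine squeeze_zero_norm' ?_ hreal
    filter_upwards [eventually_gt_atTop 0, hcost.eventually_lt_const ENNReal.zero_lt_top]
      with n hn hfin
    have hfin' : gapCost μ (wordPow ν n) (m n) ≠ ⊤ := by
      intro htop
      rw [htop, ENNReal.top_div_of_ne_top (ENNReal.natCast_ne_top n)] at hfin
      exact lt_irrefl _ hfin
    obtain ⟨h1, h2⟩ := (hν.pow n).entropy_comparison hμ (m n)
    have := abs_toReal_sub_le (entropy_map_prod_wordPow_ne_top hμ' (m n)) hfin' h1 h2
    rw [← sub_div, norm_div, Real.norm_eq_abs, Real.norm_natCast, Function.comp,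
      ENNReal.toReal_div, ENNReal.toReal_natCast]
    exact div_le_div_of_nonneg_right this (Nat.cast_nonneg n)
  simpa using hdiff.add hwalk

end Limit

end StoppedWalk
namespace StoppedWalk

section Path

variable {G Ω : Type*}

/-- The event that the first `n` increments are `v 0, …, v (n - 1)`. -/
def cylinder (Ω : Type*) (v : ℕ → G) (n : ℕ) : Set ((ℕ → G) × (ℕ → Ω)) :=
  {p | ∀ i < n, p.1 i = v i}

lemma cylinder_succ (v : ℕ → G) (n : ℕ) :
    cylinder Ω v (n + 1) = cylinder Ω v n ∩ (fun p => p.1 n) ⁻¹' {v n} := by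
  ext p
  simp only [cylinder, Set.mem_ofPred_eq, Set.mem_inter_iff, Set.mem_preimage,
    Set.mem_singleton_iff, Nat.forall_lt_succ_right]

lemma cylinder_congr {v v' : ℕ → G} {n : ℕ} (h : ∀ i < n, v i = v' i) :
    cylinder Ω v n = cylinder Ω v' n := by
  ext p
  exact forall₂_congr fun i hi => by rw [h i hi]

lemma measurableSet_cylinder [MeasurableSpace G] [DiscreteMeasurableSpace G] [MeasurableSpace Ω]
    (v : ℕ → G) (n : ℕ) : MeasurableSet (cylinder Ω v n) := by
  have : cylinder Ω v n = ⋂ i, ⋂ (_ : i < n), (fun p => p.1 i) ⁻¹' {v i} := by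
    ext p; simp [cylinder]
  rw [this]
  refine MeasurableSet.iInter fun i => MeasurableSet.iInter fun _ => ?_
  exact (measurable_pi_apply i |>.comp measurable_fst) (measurableSet_singleton _)

lemma rwPos_succ [Group G] (h : ℕ → G) (n : ℕ) : rwPos h (n + 1) = rwPos h n * h n := by
  simp [rwPos, List.range_succ]

lemma rwPos_congr [Group G] {h h' : ℕ → G} {n : ℕ} (hh : ∀ i < n, h i = h' i) :
    rwPos h n = rwPos h' n := by
  unfold rwPos
  congr 1
  exact List.map_congr_left fun i hi => hh i (List.mem_range.1 hi)

lemma measurable_rwPos [Group G] [Countable G] [MeasurableSpace G] [DiscreteMeasurableSpace G]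
    (n : ℕ) : Measurable fun h : ℕ → G => rwPos h n := by
  induction n with
  | zero => simp [rwPos]
  | succ n ih =>
    simp only [rwPos_succ]
    exact (measurable_of_countable fun x : G × G => x.1 * x.2).comp
      (ih.prodMk (measurable_pi_apply n))

lemma tsum_measure_inter_preimage {X Y : Type*} [MeasurableSpace X] [Countable Y]
    (P : Measure X) {f : X → Y} (hf : ∀ y, MeasurableSet (f ⁻¹' {y})) {A : Set X}
    (hA : MeasurableSet A) : ∑' y, P (A ∩ f ⁻¹' {y}) = P A := by
  rw [← measure_iUnion _ fun y => hA.inter (hf y)]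
  · congr 1
    ext x
    simp
  · intro y y' hyy'
    refine Set.disjoint_left.2 fun x hx hx' => hyy' ?_
    rw [← hx.2, ← hx'.2]

end Path

section Law

variable {G Ω : Type*} [MeasurableSpace G] [MeasurableSpace Ω]
  {μ : PMF G} {θ : Measure Ω} [IsProbabilityMeasure θ]
  {P : Measure ((ℕ → G) × (ℕ → Ω))} [IsProbabilityMeasure P]

/-- The increments are independent and `μ`-distributed, the randomization variables are
independent and `θ`-distributed, and the two sequences are independent. -/
def IsWalkLaw (μ : PMF G) (θ : Measure Ω) (P : Measure ((ℕ → G) × (ℕ → Ω))) : Prop :=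
  ∀ (n : ℕ) (g : ℕ → G) (B : ℕ → Set Ω), (∀ i, MeasurableSet (B i)) →
    P {p | ∀ i < n, p.1 i = g i ∧ p.2 i ∈ B i}
      = (∏ i ∈ Finset.range n, μ (g i)) * ∏ i ∈ Finset.range n, θ (B i)

lemma IsWalkLaw.measure_cylinder_inter (hP : IsWalkLaw μ θ P) (v : ℕ → G) (n : ℕ)
    {D : Set (Fin n → Ω)} (hD : MeasurableSet D) :
    P (cylinder Ω v n ∩ (fun p => fun i : Fin n => p.2 i) ⁻¹' D)
      = (∏ i ∈ Finset.range n, μ (v i)) * Measure.pi (fun _ : Fin n => θ) D := by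
  set r : (ℕ → G) × (ℕ → Ω) → Fin n → Ω := fun p i => p.2 i
  have hr : Measurable r :=
    measurable_pi_lambda _ fun i => (measurable_pi_apply (i : ℕ)).comp measurable_snd
  have hc : ∏ i ∈ Finset.range n, μ (v i) ≠ ⊤ := ENNReal.prod_ne_top fun i _ => μ.apply_ne_top _
  have hbox : ∀ s : Fin n → Set Ω, (∀ i, MeasurableSet (s i)) →
      (P.restrict (cylinder Ω v n)).map r (Set.univ.pi s)
        = ((∏ i ∈ Finset.range n, μ (v i)) • Measure.pi fun _ : Fin n => θ) (Set.univ.pi s) := by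
    intro s hs
    set B : ℕ → Set Ω := fun i => if h : i < n then s ⟨i, h⟩ else Set.univ with hB
    have hBm : ∀ i, MeasurableSet (B i) := fun i => by
      by_cases h : i < n
      · simp only [hB, h, dite_true]; exact hs _
      · simp [hB, h]
    rw [Measure.map_apply hr (MeasurableSet.univ_pi hs),
      Measure.restrict_apply (hr (MeasurableSet.univ_pi hs)), Measure.smul_apply, Measure.pi_pi,
      smul_eq_mul]
    convert hP n v B hBm using 2
    · ext p
      simp only [Set.mem_inter_iff, Set.mem_preimage, Set.mem_univ_pi, cylinder,
        Set.mem_ofPred_eq, r]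
      constructor
      · rintro ⟨h1, h2⟩ i hi
        refine ⟨h2 i hi, ?_⟩
        simp only [hB, hi, dite_true]
        exact h1 ⟨i, hi⟩
      · intro h
        refine ⟨fun i => ?_, fun i hi => (h i hi).1⟩
        have := (h i i.2).2
        simpa only [hB, i.2, dite_true] using this
    · rw [Finset.prod_range]
      exact Finset.prod_congr rfl fun i _ => by simp [hB]
  have hM : (P.restrict (cylinder Ω v n)).map r
      = (∏ i ∈ Finset.range n, μ (v i)) • Measure.pi fun _ : Fin n => θ := by
    refine ext_of_generate_finite _ generateFrom_pi.symm isPiSystem_pi ?_ ?_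
    · rintro _ ⟨s, hs, rfl⟩
      exact hbox s fun i => hs i (Set.mem_univ i)
    · have := hbox (fun _ => Set.univ) fun _ => MeasurableSet.univ
      rwa [Set.pi_univ] at this
  have := congrArg (fun M => M D) hM
  simp only [Measure.smul_apply, smul_eq_mul] at this
  rwa [Measure.map_apply hr hD, Measure.restrict_apply (hr hD), Set.inter_comm] at this

lemma IsWalkLaw.measure_cylinder (hP : IsWalkLaw μ θ P) (v : ℕ → G) (n : ℕ) :
    P (cylinder Ω v n) = (((List.range n).map v).map μ).prod := by
  have h := hP.measure_cylinder_inter v n MeasurableSet.univ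
  simp only [Set.preimage_univ, Set.inter_univ, measure_univ, mul_one] at h
  rw [h]
  clear h
  induction n with
  | zero => simp
  | succ n ih => simp [Finset.prod_range_succ, List.range_succ, ih]

end Law

section Walk

variable {G : Type*} [Group G] [Countable G] [MeasurableSpace G] [DiscreteMeasurableSpace G]
  {Ω : Type*} [MeasurableSpace Ω]

lemma IsRMST.measurableSet {τ : (ℕ → G) × (ℕ → Ω) → ℕ} (hτ : IsRMST τ) (k : ℕ) :
    MeasurableSet {p | τ p = k} := by
  have hle : rposSigma G Ω k ≤ (inferInstance : MeasurableSpace ((ℕ → G) × (ℕ → Ω))) := by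
    refine Measurable.comap_le (Measurable.prodMk ?_ ?_)
    · exact measurable_pi_lambda _ fun i => (measurable_rwPos (i : ℕ)).comp measurable_fst
    · exact measurable_pi_lambda _ fun i => (measurable_pi_apply (i : ℕ)).comp measurable_snd
  exact hle _ (hτ k)

variable {μ : PMF G} {θ : Measure Ω} [IsProbabilityMeasure θ]
  {P : Measure ((ℕ → G) × (ℕ → Ω))} [IsProbabilityMeasure P]

/-- The Markov property: the increment at time `m ≥ k` is independent of the earlier increments
and of the event that the stopping time equals `k`. -/
lemma IsWalkLaw.measure_stopped_inter_succ (hP : IsWalkLaw μ θ P)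
    {τ : (ℕ → G) × (ℕ → Ω) → ℕ} (hτ : IsRMST τ) (v : ℕ → G) {k m : ℕ} (hkm : k ≤ m) :
    P ({p | τ p = k} ∩ cylinder Ω v (m + 1)) = P ({p | τ p = k} ∩ cylinder Ω v m) * μ (v m) := by
  obtain ⟨S, hS, hSτ⟩ := hτ k
  set e : Fin (k + 1) → Fin (m + 1) := Fin.castLE (by omega)
  set D : Set (Fin (m + 1) → Ω) :=
    (fun ω => ((fun i : Fin (k + 1) => rwPos v i), fun i => ω (e i))) ⁻¹' S
  have hD : MeasurableSet D := by
    refine Measurable.prodMk measurable_const ?_ hS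
    exact measurable_pi_lambda _ fun i => measurable_pi_apply (e i)
  have key : ∀ v' : ℕ → G, (∀ i < m, v' i = v i) →
      P ({p | τ p = k} ∩ cylinder Ω v' (m + 1))
        = (∏ i ∈ Finset.range m, μ (v i)) * μ (v' m) * Measure.pi (fun _ => θ) D := by
    intro v' hv'
    have hset : {p | τ p = k} ∩ cylinder Ω v' (m + 1)
        = cylinder Ω v' (m + 1) ∩ (fun p => fun i : Fin (m + 1) => p.2 i) ⁻¹' D := by
      rw [Set.inter_comm, ← hSτ]
      ext p
      simp only [Set.mem_inter_iff, Set.mem_preimage, D]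
      refine and_congr_right fun hp => ?_
      have : (fun i : Fin (k + 1) => rwPos p.1 (i : ℕ)) = fun i : Fin (k + 1) => rwPos v i := by
        funext i
        refine rwPos_congr fun j hj => ?_
        have hjm : j < m := by omega
        rw [hp j (by omega), hv' j hjm]
      rw [this]
      rfl
    rw [hset, hP.measure_cylinder_inter v' (m + 1) hD, Finset.prod_range_succ]
    congr 2
    exact Finset.prod_congr rfl fun i hi => by rw [hv' i (Finset.mem_range.1 hi)]
  have hsum : P ({p | τ p = k} ∩ cylinder Ω v m)
      = (∏ i ∈ Finset.range m, μ (v i)) * Measure.pi (fun _ => θ) D := by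
    rw [← tsum_measure_inter_preimage P (f := fun p => p.1 m)
      (fun g => (measurable_pi_apply m).comp measurable_fst (measurableSet_singleton g))
      ((IsRMST.measurableSet hτ k).inter (measurableSet_cylinder v m))]
    have hterm : ∀ g, P ({p | τ p = k} ∩ cylinder Ω v m ∩ (fun p => p.1 m) ⁻¹' {g})
        = μ g * ((∏ i ∈ Finset.range m, μ (v i)) * Measure.pi (fun _ => θ) D) := by
      intro g
      have hv' : ∀ i < m, Function.update v m g i = v i := fun i hi =>
        Function.update_of_ne hi.ne _ _
      have := key _ hv'
      rw [cylinder_succ, cylinder_congr hv', ← Set.inter_assoc, Function.update_self] at this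
      rw [this]
      ring
    simp only [hterm, ENNReal.tsum_mul_right, PMF.tsum_coe, one_mul]
  rw [key v fun _ _ => rfl, hsum]
  ring

lemma IsWalkLaw.measure_stopped_inter (hP : IsWalkLaw μ θ P)
    {τ : (ℕ → G) × (ℕ → Ω) → ℕ} (hτ : IsRMST τ) (v : ℕ → G) {k m : ℕ} (hkm : k ≤ m) :
    P ({p | τ p = k} ∩ cylinder Ω v m)
      = P ({p | τ p = k} ∩ cylinder Ω v k) * ((((List.range m).map v).drop k).map μ).prod := by
  induction m, hkm using Nat.le_induction with
  | base => simp [List.drop_of_length_le]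
  | succ m hkm ih =>
    rw [hP.measure_stopped_inter_succ hτ v hkm, ih, List.range_succ, List.map_append,
      List.drop_append_of_le_length (by simpa using hkm)]
    simp [mul_assoc]

end Walk

section StoppedWord

lemma map_append_iidWord_apply {G : Type*} [DecidableEq G] (μ : PMF G) (w z : List G) :
    ((iidWord μ (z.length - w.length)).map fun u => w.take z.length ++ u) z
      = if w.take z.length = z.take w.length then ((z.drop w.length).map μ).prod else 0 := by
  rw [PMF.map_apply]
  split_ifs with h
  · rw [tsum_eq_single (z.drop w.length)]
    · rw [h, if_pos (List.take_append_drop _ _).symm, iidWord_apply,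
        if_pos (List.length_drop)]
    · intro u hu
      rw [if_neg]
      intro hz
      rw [h] at hz
      refine hu (List.append_cancel_left (as := z.take w.length) ?_)
      rw [List.take_append_drop, ← hz]
  · refine ENNReal.tsum_eq_zero.2 fun u => if_neg fun hz => h ?_
    have h1 : (w.take z.length).length = min z.length w.length := List.length_take
    have h2 : z.take (w.take z.length).length = w.take z.length :=
      (congrArg (List.take (w.take z.length).length) hz).trans List.take_left
    rw [← h2, h1]
    conv_rhs => rw [← List.take_length (l := z), List.take_take]
    rw [min_comm]

lemma bind_map_append_iidWord_apply_of_ne {G : Type*} (μ : PMF G) (w z : List G) {m : ℕ}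
    (hm : z.length ≠ m) :
    ((iidWord μ (m - w.length)).map fun u => w.take m ++ u) z = 0 := by
  classical
  rw [PMF.map_apply]
  refine ENNReal.tsum_eq_zero.2 fun u => ?_
  split_ifs with h
  · rw [iidWord_apply, if_neg]
    intro hu
    refine hm ?_
    rw [h, List.length_append, List.length_take, hu]
    omega
  · rfl

variable {G : Type*} [Group G] [Countable G] [MeasurableSpace G] [DiscreteMeasurableSpace G]
  {Ω : Type*} [MeasurableSpace Ω] {P : Measure ((ℕ → G) × (ℕ → Ω))} [IsProbabilityMeasure P]
  {τ : (ℕ → G) × (ℕ → Ω) → ℕ}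

/-- The word formed by the increments up to the stopping time. -/
def stoppedWord (τ : (ℕ → G) × (ℕ → Ω) → ℕ) (p : (ℕ → G) × (ℕ → Ω)) : List G :=
  (List.range (τ p)).map p.1

lemma measurableSet_stoppedWord (hτ : IsRMST τ) (w : List G) :
    MeasurableSet (stoppedWord τ ⁻¹' {w}) := by
  have : stoppedWord τ ⁻¹' {w}
      = {p | τ p = w.length} ∩ cylinder Ω (fun i => w.getD i 1) w.length := by
    ext p
    simp only [Set.mem_preimage, Set.mem_singleton_iff, Set.mem_inter_iff, Set.mem_ofPred_eq,
      cylinder, stoppedWord]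
    constructor
    · intro h
      have hl : τ p = w.length := by rw [← h]; simp
      refine ⟨hl, fun i hi => ?_⟩
      subst h
      simp at hi
      simp [hi]
    · rintro ⟨hl, h⟩
      refine List.ext_getElem (by simpa using hl) fun i h1 h2 => ?_
      have := h i h2
      simp only [List.getElem_map, List.getElem_range, this]
      simp [h2]
  rw [this]
  exact (IsRMST.measurableSet hτ _).inter (measurableSet_cylinder _ _)

/-- The law of the word formed by the increments up to the stopping time. -/
lemma exists_stoppedWordLaw (P : Measure ((ℕ → G) × (ℕ → Ω))) [IsProbabilityMeasure P]
    (hτ : IsRMST τ) :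
    ∃ ν : PMF (List G), ∀ φ : List G → ℝ≥0∞, expect ν φ = ∫⁻ p, φ (stoppedWord τ p) ∂P := by
  let _ : MeasurableSpace (List G) := ⊤
  have hm : Measurable (stoppedWord τ) := measurable_to_countable' (measurableSet_stoppedWord hτ)
  have : IsProbabilityMeasure (P.map (stoppedWord τ)) :=
    Measure.isProbabilityMeasure_map hm.aemeasurable
  refine ⟨(P.map (stoppedWord τ)).toPMF, fun φ => ?_⟩
  rw [← lintegral_toMeasure, Measure.toPMF_toMeasure, lintegral_map (measurable_of_countable _) hm]

lemma IsWalkLaw.compatible {μ : PMF G} {θ : Measure Ω} [IsProbabilityMeasure θ]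
    (hP : IsWalkLaw μ θ P) (hτ : IsRMST τ) {ν : PMF (List G)}
    (hν : ∀ φ : List G → ℝ≥0∞, expect ν φ = ∫⁻ p, φ (stoppedWord τ p) ∂P) :
    Compatible μ ν := by
  classical
  intro m
  ext z
  rw [PMF.bind_apply]
  by_cases hz : z.length = m
  swap
  · simp only [bind_map_append_iidWord_apply_of_ne μ _ z hz, mul_zero, tsum_zero]
    rw [iidWord_apply, if_neg hz]
  subst hz
  set m := z.length
  set v : ℕ → G := fun i => z.getD i 1
  have hzv : z = (List.range m).map v := by
    refine List.ext_getElem (by simp [m]) fun i h1 h2 => ?_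
    simp [v, h1]
  have hslice : ∀ k, ∫⁻ p in {p | τ p = k}, ((iidWord μ (m - (stoppedWord τ p).length)).map
      fun u => (stoppedWord τ p).take m ++ u) z ∂P = P (cylinder Ω v m ∩ τ ⁻¹' {k}) := by
    intro k
    have hval : ∀ p ∈ {p | τ p = k}, ((iidWord μ (m - (stoppedWord τ p).length)).map
        fun u => (stoppedWord τ p).take m ++ u) z
          = (cylinder Ω v (min m k)).indicator (fun _ => ((z.drop k).map μ).prod) p := by
      intro p hp
      have hlen : (stoppedWord τ p).length = k := by
        rw [stoppedWord, List.length_map, List.length_range]; exact hp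
      have hiff : (stoppedWord τ p).take m = z.take k ↔ p ∈ cylinder Ω v (min m k) := by
        rw [hzv, stoppedWord, show τ p = k from hp, ← List.map_take, ← List.map_take,
          List.take_range, List.take_range, min_comm k m, List.map_inj_left]
        simp only [List.mem_range]
        rfl
      rw [map_append_iidWord_apply, hlen, Set.indicator_apply]
      simp only [m] at hiff
      simp only [hiff, m]
    rw [setLIntegral_congr_fun (IsRMST.measurableSet hτ k) hval,
      lintegral_indicator_const (measurableSet_cylinder _ _),
      Measure.restrict_apply (measurableSet_cylinder _ _)]
    rw [Set.inter_comm _ (τ ⁻¹' {k}), Set.inter_comm _ {p | τ p = k}]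
    rcases le_total k m with hk | hk
    · rw [min_eq_right hk]
      refine Eq.trans ?_ (hP.measure_stopped_inter hτ v hk).symm
      rw [← hzv, mul_comm]
    · rw [min_eq_left hk, List.drop_of_length_le hk]
      simp
      rfl
  have hcover : ⋃ k, {p | τ p = k} = Set.univ := by ext p; simp
  have hint := hν fun w => ((iidWord μ (m - w.length)).map fun u => w.take m ++ u) z
  rw [expect] at hint
  rw [hint, ← setLIntegral_univ, ← hcover, lintegral_iUnion (IsRMST.measurableSet hτ)]
  · simp only [hslice]
    rw [tsum_measure_inter_preimage P (fun k => IsRMST.measurableSet hτ k)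
      (measurableSet_cylinder v m), hP.measure_cylinder, ← hzv, iidWord_apply, if_pos rfl]
  · intro k k' hkk'
    refine Set.disjoint_left.2 fun p hp hp' => hkk' ?_
    exact hp.symm.trans hp'

end StoppedWord

end StoppedWalk

/-- If `τ` is a randomized Markov stopping time with finite expectation for the
random walk `(G, μ)` (with `H(μ) < ∞`), then `h(μ_τ) = E(τ) · h(μ)`. -/
theorem asymptotic_entropy_of_randomized_stopped_walk
    {G : Type*} [Group G] [Countable G] [MeasurableSpace G] [DiscreteMeasurableSpace G]
    {Ω : Type*} [MeasurableSpace Ω] [StandardBorelSpace Ω]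
    (μf : G → ℝ≥0∞) (hprob : ∑' g : G, μf g = 1)
    (hent : Summable fun g : G => (μf g).toReal * Real.log (μf g).toReal)
    (θ : Measure Ω) [IsProbabilityMeasure θ]
    (P : Measure ((ℕ → G) × (ℕ → Ω))) [IsProbabilityMeasure P]
    (hP : ∀ (n : ℕ) (g : ℕ → G) (B : ℕ → Set Ω), (∀ i, MeasurableSet (B i)) →
      P {p | ∀ i < n, p.1 i = g i ∧ p.2 i ∈ B i}
        = (∏ i ∈ Finset.range n, μf (g i)) * ∏ i ∈ Finset.range n, θ (B i))
    (τ : (ℕ → G) × (ℕ → Ω) → ℕ) (hτ : IsRMST τ)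
    (hτfin : ∫⁻ p, (τ p : ℝ≥0∞) ∂P ≠ ∞) :
    ∃ h : ℝ,
      Tendsto (fun n : ℕ => fent (fconvPow μf n) / (n : ℝ)) atTop (𝓝 h) ∧
      Tendsto (fun n : ℕ =>
          fent (fconvPow (fun g : G => P {p | rwPos p.1 (τ p) = g}) n) / (n : ℝ))
        atTop (𝓝 ((∫⁻ p, (τ p : ℝ≥0∞) ∂P).toReal * h)) := by
  classical
  set μ : PMF G := ⟨μf, hprob ▸ ENNReal.summable.hasSum⟩
  have hP' : StoppedWalk.IsWalkLaw μ θ P := hP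
  obtain ⟨ν, hν⟩ := StoppedWalk.exists_stoppedWordLaw P hτ
  have hμ : StoppedWalk.entropy μ ≠ ⊤ := StoppedWalk.entropy_ne_top_of_summable hent
  have hlen : (StoppedWalk.expect ν fun w => (w.length : ℝ≥0∞)) = ∫⁻ p, (τ p : ℝ≥0∞) ∂P := by
    rw [hν]
    simp [StoppedWalk.stoppedWord]
  have hlaw : (fun g : G => P {p | rwPos p.1 (τ p) = g}) = ⇑(ν.map List.prod) := by
    funext g
    have h1 : (ν.map List.prod) g
        = StoppedWalk.expect ν fun w => if g = w.prod then 1 else 0 := by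
      rw [PMF.map_apply, StoppedWalk.expect]
      simp
    have h2 : MeasurableSet {p | rwPos p.1 (τ p) = g} := by
      have : {p | rwPos p.1 (τ p) = g}
          = ⋃ w ∈ {w : List G | w.prod = g}, StoppedWalk.stoppedWord τ ⁻¹' {w} := by
        ext p
        simp [rwPos, StoppedWalk.stoppedWord]
      rw [this]
      exact MeasurableSet.biUnion (Set.to_countable _) fun w _ =>
        StoppedWalk.measurableSet_stoppedWord hτ w
    rw [h1, hν, ← lintegral_indicator_one h2]
    refine lintegral_congr fun p => ?_
    simp only [Set.indicator_apply, Set.mem_ofPred_eq, rwPos, StoppedWalk.stoppedWord,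
      Pi.one_apply, eq_comm]
    congr
  obtain ⟨h, h1, h2⟩ := (hP'.compatible hτ hν).exists_tendsto_entropy hμ (hlen ▸ hτfin)
  refine ⟨h, h1.congr fun n => ?_, ?_⟩
  · rw [StoppedWalk.iidWord, ← StoppedWalk.fent_eq_toReal_entropy,
      ← StoppedWalk.fconvPow_map_prod, StoppedWalk.map_prod_singleton]
    rfl
  · rw [hlaw, ← hlen]
    refine h2.congr fun n => ?_
    rw [← StoppedWalk.fent_eq_toReal_entropy, ← StoppedWalk.fconvPow_map_prod]
end

section
/- Let G be a countable group and μ a probability measure on G with finite entropy H(μ). Suppose μ = α + β where α and β are sub-probability measures on G with 0 < ‖β‖ ≤ 1, and define μ' = β + ∑_{i≥1} α^{*i} * β. Then the asymptotic entropies satisfy h(μ') = h(μ)/‖β‖, where ‖β‖ is the total mass of β. -/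
open MeasureTheory Filter Real Topology ENNReal

/-- The pairing `∑_g f(g) φ(g)` of a density with a nonnegative function. -/
noncomputable def pairing {G : Type*} (f φ : G → ℝ≥0∞) : ℝ≥0∞ := ∑' g, f g * φ g

/-- The information content `-log x` of an event of probability `x`. -/
noncomputable def infoContent (x : ℝ≥0∞) : ℝ≥0∞ :=
  if x = 0 then ⊤ else ENNReal.ofReal (-Real.log x.toReal)

/-- The entropy of a sub-probability density, as an extended nonnegative real. -/
noncomputable def entropy {G : Type*} (f : G → ℝ≥0∞) : ℝ≥0∞ :=
  pairing f fun g => infoContent (f g)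

section InfoContent

theorem infoContent_anti {x y : ℝ≥0∞} (h : x ≤ y) : infoContent y ≤ infoContent x := by
  unfold infoContent
  by_cases hx : x = 0
  · simp [hx]
  have hy : y ≠ 0 := fun h0 => hx (le_antisymm (h0 ▸ h) bot_le)
  rw [if_neg hx, if_neg hy]
  by_cases hyt : y = ⊤
  · simp [hyt]
  have hxt : x ≠ ⊤ := ne_top_of_le_ne_top hyt h
  apply ENNReal.ofReal_le_ofReal
  have := Real.log_le_log (ENNReal.toReal_pos hx hxt) (ENNReal.toReal_mono hyt h)
  linarith

theorem infoContent_mul_le (x y : ℝ≥0∞) :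
    infoContent (x * y) ≤ infoContent x + infoContent y := by
  unfold infoContent
  by_cases hx : x = 0
  · simp [hx]
  by_cases hy : y = 0
  · simp [hy]
  rw [if_neg hx, if_neg hy, if_neg (mul_ne_zero hx hy)]
  by_cases hxt : x = ⊤
  · simp [hxt, hy]
  by_cases hyt : y = ⊤
  · simp [hyt, hx]
  rw [ENNReal.toReal_mul, Real.log_mul (ENNReal.toReal_pos hx hxt).ne'
    (ENNReal.toReal_pos hy hyt).ne', neg_add]
  exact ENNReal.ofReal_add_le

theorem mul_infoContent_eq_ofReal {x : ℝ≥0∞} (hx : x ≤ 1) :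
    x * infoContent x = ENNReal.ofReal (-(x.toReal * Real.log x.toReal)) := by
  unfold infoContent
  by_cases h0 : x = 0
  · simp [h0]
  have hxt : x ≠ ⊤ := ne_top_of_le_ne_top one_ne_top hx
  rw [if_neg h0]
  nth_rw 1 [← ENNReal.ofReal_toReal hxt]
  rw [← ENNReal.ofReal_mul ENNReal.toReal_nonneg, mul_neg]

theorem neg_mul_log_toReal_nonneg {x : ℝ≥0∞} (hx : x ≤ 1) :
    0 ≤ -(x.toReal * Real.log x.toReal) := by
  rw [← mul_neg]
  exact mul_nonneg ENNReal.toReal_nonneg (neg_nonneg.2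
    (Real.log_nonpos ENNReal.toReal_nonneg (ENNReal.toReal_le_of_le_ofReal zero_le_one (by simpa))))

theorem mul_infoContent_ne_top {x : ℝ≥0∞} (hx : x ≤ 1) : x * infoContent x ≠ ⊤ := by
  rw [mul_infoContent_eq_ofReal hx]; exact ENNReal.ofReal_ne_top

theorem mul_infoContent_add_le {x y : ℝ≥0∞} (hx : x ≤ 1) (hy : y ≤ 1) :
    x * infoContent x + x ≤ x * infoContent y + y := by
  by_cases hx0 : x = 0
  · simp [hx0]
  by_cases hy0 : y = 0
  · simp [hy0, infoContent, ENNReal.mul_top hx0]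
  have hxt : x ≠ ⊤ := ne_top_of_le_ne_top one_ne_top hx
  have hyt : y ≠ ⊤ := ne_top_of_le_ne_top one_ne_top hy
  have hx' := ENNReal.toReal_pos hx0 hxt
  have hy' := ENNReal.toReal_pos hy0 hyt
  have hy1 : y.toReal ≤ 1 := ENNReal.toReal_le_of_le_ofReal zero_le_one (by simpa)
  have hly : 0 ≤ -Real.log y.toReal := neg_nonneg.2 (Real.log_nonpos hy'.le hy1)
  rw [mul_infoContent_eq_ofReal hx, infoContent, if_neg hy0]
  calc _ = ENNReal.ofReal (-(x.toReal * Real.log x.toReal)) + ENNReal.ofReal x.toReal := by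
        rw [ENNReal.ofReal_toReal hxt]
    _ ≤ ENNReal.ofReal (x.toReal * -Real.log y.toReal) + ENNReal.ofReal y.toReal := ?_
    _ = _ := by
        rw [ENNReal.ofReal_mul hx'.le, ENNReal.ofReal_toReal hxt, ENNReal.ofReal_toReal hyt]
  rw [← ENNReal.ofReal_add (neg_mul_log_toReal_nonneg hx) hx'.le,
    ← ENNReal.ofReal_add (mul_nonneg hx'.le hly) hy'.le]
  apply ENNReal.ofReal_le_ofReal
  have h1 := Real.log_le_sub_one_of_pos (div_pos hy' hx')
  rw [Real.log_div hy'.ne' hx'.ne'] at h1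
  have h2 := mul_le_mul_of_nonneg_left h1 hx'.le
  have h3 : x.toReal * (y.toReal / x.toReal - 1) = y.toReal - x.toReal := by field_simp
  rw [h3] at h2
  linarith

theorem mul_infoContent_le_of_le {x y : ℝ≥0∞} (hxy : x ≤ y) (hy : y ≤ 1) :
    x * infoContent x ≤ y * infoContent y + y :=
  calc x * infoContent x ≤ x * infoContent x + x := le_self_add
    _ ≤ x * infoContent y + y := mul_infoContent_add_le (hxy.trans hy) hy
    _ ≤ y * infoContent y + y := by gcongr

end InfoContent

section Pairing

variable {G : Type*}

theorem pairing_add (f φ ψ : G → ℝ≥0∞) :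
    pairing f (fun g => φ g + ψ g) = pairing f φ + pairing f ψ := by
  simp only [pairing, mul_add, ENNReal.tsum_add]

theorem add_pairing (f f' φ : G → ℝ≥0∞) :
    pairing (fun g => f g + f' g) φ = pairing f φ + pairing f' φ := by
  simp only [pairing, add_mul, ENNReal.tsum_add]

theorem tsum_pairing {ι : Type*} (f : ι → G → ℝ≥0∞) (φ : G → ℝ≥0∞) :
    pairing (fun g => ∑' i, f i g) φ = ∑' i, pairing (f i) φ := by
  simp only [pairing, ← ENNReal.tsum_mul_right]
  exact ENNReal.tsum_comm

theorem pairing_tsum {ι : Type*} (f : G → ℝ≥0∞) (φ : ι → G → ℝ≥0∞) :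
    pairing f (fun g => ∑' i, φ i g) = ∑' i, pairing f (φ i) := by
  simp only [pairing, ← ENNReal.tsum_mul_left]
  exact ENNReal.tsum_comm

theorem pairing_const (f : G → ℝ≥0∞) (c : ℝ≥0∞) : pairing f (fun _ => c) = (∑' g, f g) * c :=
  ENNReal.tsum_mul_right

theorem pairing_mono (f : G → ℝ≥0∞) {φ ψ : G → ℝ≥0∞} (h : ∀ g, φ g ≤ ψ g) :
    pairing f φ ≤ pairing f ψ :=
  ENNReal.tsum_le_tsum fun g => mul_le_mul_right (h g) _

theorem pairing_const_mul (f φ : G → ℝ≥0∞) (c : ℝ≥0∞) :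
    pairing f (fun g => c * φ g) = c * pairing f φ := by
  simp only [pairing, ← ENNReal.tsum_mul_left, mul_left_comm]

theorem mul_le_pairing (f φ : G → ℝ≥0∞) (g : G) : f g * φ g ≤ pairing f φ :=
  ENNReal.le_tsum g

open scoped Classical in
theorem pairing_ite (f : G → ℝ≥0∞) (x : G) : pairing f (fun g => if g = x then 1 else 0) = f x := by
  simp [pairing]

theorem le_one_of_tsum_le_one {f : G → ℝ≥0∞} (h : ∑' g, f g ≤ 1) (g : G) : f g ≤ 1 :=
  (ENNReal.le_tsum g).trans h

/-- Gibbs' inequality. -/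
theorem entropy_le_pairing_infoContent {f q : G → ℝ≥0∞} (hf : ∑' g, f g = 1)
    (hq : ∑' g, q g ≤ 1) : entropy f ≤ pairing f fun g => infoContent (q g) := by
  have h : ∑' g, (f g * infoContent (f g) + f g) ≤ ∑' g, (f g * infoContent (q g) + q g) :=
    ENNReal.tsum_le_tsum fun g => mul_infoContent_add_le (le_one_of_tsum_le_one hf.le g)
      (le_one_of_tsum_le_one hq g)
  rw [ENNReal.tsum_add, ENNReal.tsum_add, hf] at h
  exact (ENNReal.add_le_add_iff_right one_ne_top).1 (h.trans (add_le_add le_rfl hq))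

theorem entropy_le_of_le {f f' : G → ℝ≥0∞} (h : ∀ g, f g ≤ f' g) (h' : ∑' g, f' g ≤ 1) :
    entropy f ≤ entropy f' + 1 :=
  calc entropy f ≤ ∑' g, (f' g * infoContent (f' g) + f' g) :=
        ENNReal.tsum_le_tsum fun g => mul_infoContent_le_of_le (h g) (le_one_of_tsum_le_one h' g)
    _ ≤ entropy f' + 1 := by rw [ENNReal.tsum_add]; exact add_le_add le_rfl h'

theorem fent_eq_toReal_entropy {f : G → ℝ≥0∞} (hf : ∑' g, f g ≤ 1) :
    fent f = (entropy f).toReal := by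
  have h1 := fun g => le_one_of_tsum_le_one hf g
  rw [fent, entropy, pairing, ENNReal.tsum_toReal_eq fun g => mul_infoContent_ne_top (h1 g),
    ← tsum_neg]
  refine tsum_congr fun g => ?_
  rw [mul_infoContent_eq_ofReal (h1 g), ENNReal.toReal_ofReal (neg_mul_log_toReal_nonneg (h1 g))]

theorem entropy_ne_top_of_summable {f : G → ℝ≥0∞} (hf : ∑' g, f g ≤ 1)
    (h : Summable fun g => (f g).toReal * Real.log (f g).toReal) : entropy f ≠ ⊤ := by
  have h1 := fun g => le_one_of_tsum_le_one hf g
  have := h.neg.tsum_ofReal_ne_top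
  simpa only [entropy, pairing, fun g => mul_infoContent_eq_ofReal (h1 g)] using this

end Pairing

section Convolution

variable {G : Type*} [Group G]

theorem pairing_fconv (f f' φ : G → ℝ≥0∞) :
    pairing (fconv f f') φ = pairing f fun x => pairing f' fun y => φ (x * y) := by
  simp only [pairing, fconv, ← ENNReal.tsum_mul_right, ← ENNReal.tsum_mul_left]
  rw [ENNReal.tsum_comm]
  refine tsum_congr fun x => ?_
  rw [← (Equiv.mulLeft x).tsum_eq]
  simp [mul_assoc]

theorem pairing_fconvPow_zero (f φ : G → ℝ≥0∞) : pairing (fconvPow f 0) φ = φ 1 := by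
  simp [pairing, fconvPow]

theorem pairing_fconvPow_add (f φ : G → ℝ≥0∞) (m n : ℕ) :
    pairing (fconvPow f (m + n)) φ =
      pairing (fconvPow f m) fun x => pairing (fconvPow f n) fun y => φ (x * y) := by
  induction n generalizing φ with
  | zero => simp [pairing_fconvPow_zero]
  | succ n ih =>
    rw [← add_assoc]
    simp only [fconvPow, pairing_fconv, ih, mul_assoc]

theorem fconvPow_one (f : G → ℝ≥0∞) : fconvPow f 1 = f := by
  funext x
  classical
  rw [← pairing_ite (fconvPow f 1), fconvPow, pairing_fconv, pairing_fconvPow_zero]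
  simp [pairing_ite]

theorem pairing_fconvPow_succ (f φ : G → ℝ≥0∞) (n : ℕ) :
    pairing (fconvPow f (n + 1)) φ =
      pairing f fun x => pairing (fconvPow f n) fun y => φ (x * y) := by
  rw [add_comm, pairing_fconvPow_add, fconvPow_one]

theorem tsum_fconvPow {f : G → ℝ≥0∞} (n : ℕ) :
    ∑' g, fconvPow f n g = (∑' g, f g) ^ n := by
  have key : ∀ f : G → ℝ≥0∞, ∑' g, f g = pairing f fun _ => 1 := fun f => by
    simp [pairing_const]
  rw [key]
  induction n with
  | zero => simp [pairing_fconvPow_zero]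
  | succ n ih =>
    rw [pairing_fconvPow_succ, ih, pairing_const, pow_succ']

open scoped Classical in
theorem fconvPow_mul_le (f : G → ℝ≥0∞) (m n : ℕ) (x y : G) :
    fconvPow f m x * fconvPow f n y ≤ fconvPow f (m + n) (x * y) := by
  rw [← pairing_ite (fconvPow f (m + n)), pairing_fconvPow_add]
  refine le_trans ?_ (mul_le_pairing _ _ x)
  gcongr
  simp [pairing_ite]

theorem entropy_fconvPow_zero (f : G → ℝ≥0∞) : entropy (fconvPow f 0) = 0 := by
  rw [entropy, pairing_fconvPow_zero]
  simp [fconvPow, infoContent]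

theorem entropy_fconvPow_add_le {f : G → ℝ≥0∞} (hf : ∑' g, f g = 1) (m n : ℕ) :
    entropy (fconvPow f (m + n)) ≤ entropy (fconvPow f m) + entropy (fconvPow f n) := by
  calc entropy (fconvPow f (m + n))
      ≤ pairing (fconvPow f m) fun x => pairing (fconvPow f n) fun y =>
          infoContent (fconvPow f m x) + infoContent (fconvPow f n y) := by
        rw [entropy, pairing_fconvPow_add]
        exact pairing_mono _ fun x => pairing_mono _ fun y =>
          (infoContent_anti (fconvPow_mul_le f m n x y)).trans (infoContent_mul_le _ _)
    _ = entropy (fconvPow f m) + entropy (fconvPow f n) := by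
        simp only [pairing_add, pairing_const, tsum_fconvPow, hf, one_pow, one_mul, entropy]

theorem entropy_fconvPow_le {f : G → ℝ≥0∞} (hf : ∑' g, f g = 1) (n : ℕ) :
    entropy (fconvPow f n) ≤ n * entropy f := by
  induction n with
  | zero => simp [entropy_fconvPow_zero]
  | succ n ih =>
    calc _ ≤ entropy (fconvPow f n) + entropy (fconvPow f 1) := entropy_fconvPow_add_le hf n 1
      _ ≤ n * entropy f + entropy f := by rw [fconvPow_one]; gcongr
      _ = _ := by push_cast; ring

theorem entropy_fconvPow_ne_top {f : G → ℝ≥0∞} (hf : ∑' g, f g = 1) (h : entropy f ≠ ⊤) (n : ℕ) :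
    entropy (fconvPow f n) ≠ ⊤ :=
  ne_top_of_le_ne_top (ENNReal.mul_ne_top (ENNReal.natCast_ne_top n) h) (entropy_fconvPow_le hf n)

theorem exists_tendsto_entropy_fconvPow {f : G → ℝ≥0∞} (hf : ∑' g, f g = 1) (h : entropy f ≠ ⊤) :
    ∃ l, Tendsto (fun n : ℕ => (entropy (fconvPow f n)).toReal / n) atTop (𝓝 l) := by
  have hsub : Subadditive fun n : ℕ => (entropy (fconvPow f n)).toReal := fun m n => by
    rw [← ENNReal.toReal_add (entropy_fconvPow_ne_top hf h m) (entropy_fconvPow_ne_top hf h n)]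
    exact ENNReal.toReal_mono (ENNReal.add_ne_top.2
      ⟨entropy_fconvPow_ne_top hf h m, entropy_fconvPow_ne_top hf h n⟩)
      (entropy_fconvPow_add_le hf m n)
  exact ⟨hsub.lim, hsub.tendsto_lim ⟨0, by rintro _ ⟨n, rfl⟩; positivity⟩⟩

end Convolution

section Comparison

variable {G S : Type*} [Group G]

/-- If `E` averages over a random pair `(x, s)`, `f` is the law of `x * r` and `f'` the law of
`x * t`, where `r` and `t` have conditional laws `a s` and `b s`, then the entropies of `f` and
`f'` differ at most by the cost of encoding `s`, `r` and `t`. -/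
theorem entropy_le_add_expectation {E : (G → S → ℝ≥0∞) → ℝ≥0∞}
    (hmono : ∀ Φ Ψ, (∀ x s, Φ x s ≤ Ψ x s) → E Φ ≤ E Ψ)
    (hadd : ∀ Φ Ψ, E (fun x s => Φ x s + Ψ x s) = E Φ + E Ψ)
    {a b : S → G → ℝ≥0∞} (ha : ∀ s, ∑' g, a s g = 1) (hb : ∀ s, ∑' g, b s g = 1)
    {w : S → ℝ≥0∞} (hw : ∑' s, w s ≤ 1)
    {f f' : G → ℝ≥0∞} (hf : ∑' g, f g = 1) (hf' : ∑' g, f' g = 1)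
    (hE : ∀ φ : G → ℝ≥0∞, E (fun x s => pairing (a s) fun r => φ (x * r)) = pairing f φ)
    (hE' : ∀ φ : G → ℝ≥0∞, E (fun x s => pairing (b s) fun t => φ (x * t)) = pairing f' φ) :
    entropy f' ≤ entropy f +
      E fun _ s => infoContent (w s) + entropy (a s) + entropy (b s) := by
  let q : G → ℝ≥0∞ := fun g => ∑' s, w s * ∑' r, ∑' t, a s r * (b s t * f (g * t⁻¹ * r))
  have hq : ∑' g, q g ≤ 1 := by
    have hshift : ∀ r t : G, ∑' g, f (g * t⁻¹ * r) = 1 := fun r t => by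
      rw [← hf, ← (Equiv.mulRight (t⁻¹ * r)).tsum_eq f]
      simp [mul_assoc]
    have : ∑' g, q g = ∑' s, w s := by
      simp only [q]
      rw [ENNReal.tsum_comm]
      refine tsum_congr fun s => ?_
      rw [ENNReal.tsum_mul_left, ENNReal.tsum_comm]
      have : ∀ r, ∑' g, ∑' t, a s r * (b s t * f (g * t⁻¹ * r)) = a s r := fun r => by
        rw [ENNReal.tsum_comm]
        simp only [ENNReal.tsum_mul_left, hshift, mul_one, hb]
      simp only [this, ha, mul_one]
    exact this.trans_le hw
  have hlow : ∀ x s r t, w s * (a s r * (b s t * f (x * r))) ≤ q (x * t) := fun x s r t => by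
    refine le_trans ?_ (ENNReal.le_tsum s)
    gcongr
    refine le_trans ?_ (ENNReal.le_tsum r)
    refine le_trans ?_ (ENNReal.le_tsum t)
    simp
  have hinfo : ∀ x s r t, infoContent (q (x * t)) ≤
      infoContent (f (x * r)) + (infoContent (w s) + infoContent (a s r) + infoContent (b s t)) :=
    fun x s r t => calc
      _ ≤ infoContent (w s * (a s r * (b s t * f (x * r)))) := infoContent_anti (hlow x s r t)
      _ ≤ infoContent (w s) + (infoContent (a s r) +
            (infoContent (b s t) + infoContent (f (x * r)))) :=
          (infoContent_mul_le _ _).trans <| add_le_add le_rfl <|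
          (infoContent_mul_le _ _).trans <| add_le_add le_rfl <| infoContent_mul_le _ _
      _ = _ := by ring
  calc entropy f' ≤ pairing f' fun g => infoContent (q g) := entropy_le_pairing_infoContent hf' hq
    _ = E fun x s => pairing (b s) fun t => infoContent (q (x * t)) := (hE' _).symm
    _ ≤ E fun x s => (pairing (a s) fun r => infoContent (f (x * r))) +
          (infoContent (w s) + entropy (a s) + entropy (b s)) := hmono _ _ fun x s => calc
        _ = pairing (a s) fun _ => pairing (b s) fun t => infoContent (q (x * t)) := by
            rw [pairing_const, ha, one_mul]
        _ ≤ pairing (a s) fun r => pairing (b s) fun t => infoContent (f (x * r)) +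
              (infoContent (w s) + infoContent (a s r) + infoContent (b s t)) :=
            pairing_mono _ fun r => pairing_mono _ fun t => hinfo x s r t
        _ = _ := by
            simp only [pairing_add, pairing_const, ha, hb, one_mul, entropy]
    _ = entropy f + E fun _ s => infoContent (w s) + entropy (a s) + entropy (b s) := by
        rw [hadd, hE (fun g => infoContent (f g)), entropy]

end Comparison

section Willis

variable {G : Type*} [Group G]

/-- The density `∑_{i ≥ 0} α^{*i} * β`, i.e. the law of the position of the random walk at the
first step drawn from `β`. -/
noncomputable def willis (α β : G → ℝ≥0∞) : G → ℝ≥0∞ :=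
  fun g => β g + ∑' i : ℕ, fconv (fconvPow α (i + 1)) β g

theorem pairing_fconv_fconvPow_zero (α β φ : G → ℝ≥0∞) :
    pairing (fconv (fconvPow α 0) β) φ = pairing β φ := by
  simp [pairing_fconv, pairing_fconvPow_zero]

theorem pairing_fconv_fconvPow_succ (α β φ : G → ℝ≥0∞) (i : ℕ) :
    pairing (fconv (fconvPow α (i + 1)) β) φ =
      pairing α fun x => pairing (fconv (fconvPow α i) β) fun y => φ (x * y) := by
  simp only [pairing_fconv, pairing_fconvPow_succ, mul_assoc]

theorem pairing_willis_eq_tsum (α β φ : G → ℝ≥0∞) :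
    pairing (willis α β) φ = ∑' i, pairing (fconv (fconvPow α i) β) φ := by
  rw [tsum_eq_zero_add' ENNReal.summable, pairing_fconv_fconvPow_zero, ← tsum_pairing,
    ← add_pairing]
  rfl

theorem pairing_willis (α β φ : G → ℝ≥0∞) :
    pairing (willis α β) φ =
      pairing β φ + pairing α fun x => pairing (willis α β) fun y => φ (x * y) := by
  simp only [pairing_willis_eq_tsum]
  rw [pairing_tsum, tsum_eq_zero_add' ENNReal.summable, pairing_fconv_fconvPow_zero]
  simp only [pairing_fconv_fconvPow_succ]

theorem mul_willis_le (α β : G → ℝ≥0∞) (x y : G) :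
    α x * willis α β y ≤ willis α β (x * y) := by
  classical
  rw [← pairing_ite (willis α β) (x * y), pairing_willis]
  refine le_trans ?_ le_add_self
  refine le_trans ?_ (mul_le_pairing _ _ x)
  gcongr
  simp [pairing_ite]

theorem tsum_fconv_fconvPow (α β : G → ℝ≥0∞) (i : ℕ) :
    ∑' g, fconv (fconvPow α i) β g = (∑' g, α g) ^ i * ∑' g, β g := by
  have h := pairing_fconv (fconvPow α i) β fun _ => 1
  simpa only [pairing_const, mul_one, tsum_fconvPow] using h

theorem tsum_willis {α β : G → ℝ≥0∞} (h : ∑' g, α g + ∑' g, β g = 1) (hβ : ∑' g, β g ≠ 0) :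
    ∑' g, willis α β g = 1 := by
  have hw := pairing_willis_eq_tsum α β fun _ => 1
  simp only [pairing_const, mul_one, tsum_fconv_fconvPow] at hw
  have hα : ∑' g, α g ≠ ⊤ := ne_top_of_le_ne_top one_ne_top (h ▸ le_self_add)
  have hβt : ∑' g, β g ≠ ⊤ := ne_top_of_le_ne_top one_ne_top (h ▸ le_add_self)
  have hsub : 1 - ∑' g, α g = ∑' g, β g := by rw [← h, ENNReal.add_sub_cancel_left hα]
  rw [hw, ENNReal.tsum_mul_right, ENNReal.tsum_geometric, hsub, ENNReal.inv_mul_cancel hβ hβt]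

theorem entropy_willis_ne_top {α β : G → ℝ≥0∞} (h : ∑' g, α g + ∑' g, β g = 1)
    (hβ : ∑' g, β g ≠ 0) (hHα : entropy α ≠ ⊤) (hHβ : entropy β ≠ ⊤) :
    entropy (willis α β) ≠ ⊤ := by
  have hβt : ∑' g, β g ≠ ⊤ := ne_top_of_le_ne_top one_ne_top (h ▸ le_add_self)
  set φ : G → ℝ≥0∞ := fun g => infoContent (willis α β g)
  set c : ℕ → ℝ≥0∞ := fun i => pairing (fconv (fconvPow α i) β) φ
  set m : ℕ → ℝ≥0∞ := fun i => ∑' g, fconv (fconvPow α i) β g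
  have hm : ∑' i, m i = 1 := by
    have hw := pairing_willis_eq_tsum α β fun _ => 1
    simpa only [pairing_const, mul_one, tsum_willis h hβ, eq_comm] using hw
  have hc0 : c 0 ≤ entropy β := by
    simp only [c, pairing_fconv_fconvPow_zero]
    exact pairing_mono _ fun g => infoContent_anti le_self_add
  have hc : ∀ i, c (i + 1) ≤ entropy α * m i + (∑' g, α g) * c i := fun i => calc
    c (i + 1) ≤ pairing α fun x => pairing (fconv (fconvPow α i) β) fun y =>
          infoContent (α x) + φ y := by
        simp only [c, pairing_fconv_fconvPow_succ]
        exact pairing_mono _ fun x => pairing_mono _ fun y =>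
          (infoContent_anti (mul_willis_le α β x y)).trans (infoContent_mul_le _ _)
    _ = _ := by
        simp only [pairing_add, pairing_const, pairing_const_mul, entropy, c, m]
        rw [mul_comm (pairing α _)]
  set B := (entropy α + entropy β) / ∑' g, β g
  have hB : entropy α + entropy β + (∑' g, α g) * B = B := by
    have h1 : (∑' g, β g) * B = entropy α + entropy β := ENNReal.mul_div_cancel hβ hβt
    rw [← h1, ← add_mul, add_comm, h, one_mul]
  have hsum : ∀ k, ∑ i ∈ Finset.range k, c i ≤ B := fun k => by
    induction k with
    | zero => simp
    | succ k ih =>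
      rw [Finset.sum_range_succ']
      calc ∑ i ∈ Finset.range k, c (i + 1) + c 0
          ≤ ∑ i ∈ Finset.range k, (entropy α * m i + (∑' g, α g) * c i) + entropy β :=
            add_le_add (Finset.sum_le_sum fun i _ => hc i) hc0
        _ = entropy α * ∑ i ∈ Finset.range k, m i
              + (∑' g, α g) * ∑ i ∈ Finset.range k, c i + entropy β := by
            rw [Finset.sum_add_distrib, Finset.mul_sum, Finset.mul_sum]
        _ ≤ entropy α * 1 + (∑' g, α g) * B + entropy β := by
            gcongr
            exact hm ▸ ENNReal.sum_le_tsum _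
        _ = B := by rw [mul_one, add_right_comm, hB]
  have hle : entropy (willis α β) ≤ B := by
    rw [entropy, pairing_willis_eq_tsum]
    exact ENNReal.tsum_le_of_sum_range_le hsum
  refine ne_top_of_le_ne_top ?_ hle
  exact ENNReal.div_ne_top (ENNReal.add_ne_top.2 ⟨hHα, hHβ⟩) hβ

/-- Run the walk with steps from `α + β` until it has made `N` steps or `n` steps from `β`;
`stopExpect α β N n Φ` is the expectation of `Φ x (m, M)`, where `x` is the position at that time,
`m` the number of missing steps from `β`, and `M` the number of missing steps. -/
noncomputable def stopExpect (α β : G → ℝ≥0∞) : ℕ → ℕ → (G → ℕ × ℕ → ℝ≥0∞) → ℝ≥0∞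
  | 0, n, Φ => Φ 1 (n, 0)
  | N + 1, 0, Φ => Φ 1 (0, N + 1)
  | N + 1, n + 1, Φ =>
    (pairing α fun g => stopExpect α β N (n + 1) fun x s => Φ (g * x) s) +
      pairing β fun g => stopExpect α β N n fun x s => Φ (g * x) s

theorem stopExpect_mono (α β : G → ℝ≥0∞) (N n : ℕ) (Φ Ψ : G → ℕ × ℕ → ℝ≥0∞)
    (h : ∀ x s, Φ x s ≤ Ψ x s) : stopExpect α β N n Φ ≤ stopExpect α β N n Ψ := by
  induction N generalizing n Φ Ψ with
  | zero => simp only [stopExpect, h]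
  | succ N ih =>
    cases n with
    | zero => simp only [stopExpect, h]
    | succ n =>
      simp only [stopExpect]
      exact add_le_add (pairing_mono _ fun g => ih _ _ _ fun x s => h _ s)
        (pairing_mono _ fun g => ih _ _ _ fun x s => h _ s)

theorem stopExpect_add (α β : G → ℝ≥0∞) (N n : ℕ) (Φ Ψ : G → ℕ × ℕ → ℝ≥0∞) :
    stopExpect α β N n (fun x s => Φ x s + Ψ x s) =
      stopExpect α β N n Φ + stopExpect α β N n Ψ := by
  induction N generalizing n Φ Ψ with
  | zero => simp only [stopExpect]
  | succ N ih =>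
    cases n with
    | zero => simp only [stopExpect]
    | succ n =>
      simp only [stopExpect, ih, pairing_add]
      exact add_add_add_comm _ _ _ _

theorem stopExpect_pairing_fconvPow (α β φ : G → ℝ≥0∞) (N n : ℕ) :
    stopExpect α β N n
        (fun x s => pairing (fconvPow (fun g => α g + β g) s.2) fun r => φ (x * r)) =
      pairing (fconvPow (fun g => α g + β g) N) φ := by
  induction N generalizing n φ with
  | zero => simp only [stopExpect, one_mul]
  | succ N ih =>
    cases n with
    | zero => simp only [stopExpect, one_mul]
    | succ n =>
      simp only [stopExpect, mul_assoc]
      simp only [fun g n => ih (fun y => φ (g * y)) n]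
      rw [← add_pairing, ← pairing_fconvPow_succ]

theorem stopExpect_pairing_fconvPow_willis (α β φ : G → ℝ≥0∞) (N n : ℕ) :
    stopExpect α β N n
        (fun x s => pairing (fconvPow (willis α β) s.1) fun r => φ (x * r)) =
      pairing (fconvPow (willis α β) n) φ := by
  induction N generalizing n φ with
  | zero => simp only [stopExpect, one_mul]
  | succ N ih =>
    cases n with
    | zero => simp only [stopExpect, one_mul]
    | succ n =>
      simp only [stopExpect, mul_assoc]
      simp only [fun g n => ih (fun y => φ (g * y)) n]
      rw [pairing_fconvPow_succ _ φ, pairing_willis, add_comm]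
      simp only [pairing_fconvPow_succ, mul_assoc]

theorem stopExpect_le {α β : G → ℝ≥0∞} {p : ℝ} (hp : 0 < p) (hp1 : p ≤ 1)
    (hα : ∑' g, α g = ENNReal.ofReal (1 - p)) (hβ : ∑' g, β g = ENNReal.ofReal p)
    {C δ : ℝ} (hC : 0 ≤ C) (hδ : 0 < δ) {Ψ : ℕ × ℕ → ℝ≥0∞}
    (hΨ : ∀ s, Ψ s ≤ ENNReal.ofReal (C * (s.1 + s.2 + 2))) (N n : ℕ) :
    stopExpect α β N n (fun _ s => Ψ s) ≤
      ENNReal.ofReal (C * ((δ + ((n - p * N) ^ 2 + N) / δ) / (2 * p) + 2)) := by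
  have amgm : ∀ z : ℝ, 2 * z ≤ δ + z ^ 2 / δ := fun z => by
    have : δ + z ^ 2 / δ - 2 * z = (δ - z) ^ 2 / δ := by field_simp; ring
    have : 0 ≤ (δ - z) ^ 2 / δ := by positivity
    linarith
  induction N generalizing n with
  | zero =>
    simp only [stopExpect]
    refine (hΨ _).trans (ENNReal.ofReal_le_ofReal ?_)
    gcongr
    rw [le_div_iff₀ (by positivity)]
    have := amgm n
    simp only [Nat.cast_zero, mul_zero, sub_zero, add_zero]
    nlinarith [Nat.cast_nonneg (α := ℝ) n]
  | succ N ih =>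
    cases n with
    | zero =>
      simp only [stopExpect]
      refine (hΨ _).trans (ENNReal.ofReal_le_ofReal ?_)
      gcongr
      rw [le_div_iff₀ (by positivity)]
      have h1 := amgm (p * (N + 1 : ℕ))
      have h2 : 0 ≤ ((N + 1 : ℕ) : ℝ) / δ := by positivity
      simp only [Nat.cast_zero, zero_sub, zero_add, add_div, neg_sq]
      linarith
    | succ n =>
      simp only [stopExpect, pairing_const, hα, hβ]
      refine (add_le_add (mul_le_mul_right (ih _) _) (mul_le_mul_right (ih _) _)).trans ?_
      rw [← ENNReal.ofReal_mul (by linarith), ← ENNReal.ofReal_mul hp.le,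
        ← ENNReal.ofReal_add (mul_nonneg (by linarith) (by positivity)) (by positivity)]
      apply ENNReal.ofReal_le_ofReal
      push_cast
      have key : C * ((δ + ((n + 1 - p * (N + 1)) ^ 2 + (N + 1)) / δ) / (2 * p) + 2) -
          ((1 - p) * (C * ((δ + ((n + 1 - p * N) ^ 2 + N) / δ) / (2 * p) + 2)) +
            p * (C * ((δ + ((n - p * N) ^ 2 + N) / δ) / (2 * p) + 2))) =
          C * ((1 - p + p ^ 2) / δ / (2 * p)) := by
        field_simp
        ring
      have : 0 ≤ C * ((1 - p + p ^ 2) / δ / (2 * p)) := by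
        have : 0 ≤ 1 - p := by linarith
        positivity
      linarith

theorem tsum_two_inv_pow_mul :
    ∑' s : ℕ × ℕ, ENNReal.ofReal (Real.exp (-(Real.log 2 * (s.1 + s.2 + 2)))) = 1 := by
  have h : ∀ s : ℕ × ℕ, ENNReal.ofReal (Real.exp (-(Real.log 2 * (s.1 + s.2 + 2)))) =
      2⁻¹ ^ (s.1 + 1) * 2⁻¹ ^ (s.2 + 1) := fun s => by
    have h1 : Real.exp (-(Real.log 2 * (s.1 + s.2 + 2))) = 2⁻¹ ^ ((s.1 + 1) + (s.2 + 1)) := by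
      rw [← Real.exp_log (show (0 : ℝ) < 2⁻¹ by norm_num), ← Real.exp_nat_mul, Real.log_inv]
      push_cast
      ring_nf
    rw [h1, ENNReal.ofReal_pow (by norm_num), ENNReal.ofReal_inv_of_pos two_pos, pow_add]
    simp
  have h2 : ∑' n : ℕ, (2⁻¹ : ℝ≥0∞) ^ (n + 1) = 1 := by
    rw [ENNReal.tsum_geometric_add_one, ENNReal.one_sub_inv_two, inv_inv,
      ENNReal.inv_mul_cancel two_ne_zero ofNat_ne_top]
  simp only [h]
  rw [ENNReal.tsum_prod (f := fun i j : ℕ => (2⁻¹ : ℝ≥0∞) ^ (i + 1) * 2⁻¹ ^ (j + 1))]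
  simp only [ENNReal.tsum_mul_left, h2, mul_one]

end Willis

/-- The entropies after `n` steps of the `willis` walk and after `N` steps of the walk itself
differ by `O(√N)` as long as `n - ‖β‖ N` stays bounded. -/
theorem exists_abs_entropy_sub_le {G : Type*} [Group G] {α β : G → ℝ≥0∞} {p : ℝ}
    (hp : 0 < p) (hp1 : p ≤ 1)
    (hα : ∑' g, α g = ENNReal.ofReal (1 - p)) (hβ : ∑' g, β g = ENNReal.ofReal p)
    (hent : entropy (fun g => α g + β g) ≠ ⊤) :
    ∃ C : ℝ, 0 ≤ C ∧ ∀ (N n : ℕ) (δ : ℝ), 0 < δ →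
      |(entropy (fconvPow (willis α β) n)).toReal -
        (entropy (fconvPow (fun g => α g + β g) N)).toReal| ≤
      C * ((δ + ((n - p * N) ^ 2 + N) / δ) / (2 * p) + 2) := by
  have hβ0 : ∑' g, β g ≠ 0 := by simp [hβ, hp]
  have hsum : ∑' g, α g + ∑' g, β g = 1 := by
    rw [hα, hβ, ← ENNReal.ofReal_add (by linarith) hp.le]; simp
  have hμ : ∑' g, (α g + β g) = 1 := by rw [ENNReal.tsum_add, hsum]
  have hμ' : ∑' g, willis α β g = 1 := tsum_willis hsum hβ0
  have hent1 : entropy (fun g => α g + β g) + 1 ≠ ⊤ := ENNReal.add_ne_top.2 ⟨hent, one_ne_top⟩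
  have hent' : entropy (willis α β) ≠ ⊤ := entropy_willis_ne_top hsum hβ0
    (ne_top_of_le_ne_top hent1 (entropy_le_of_le (fun _ => le_self_add) hμ.le))
    (ne_top_of_le_ne_top hent1 (entropy_le_of_le (fun _ => le_add_self) hμ.le))
  set a : ℕ × ℕ → G → ℝ≥0∞ := fun s => fconvPow (fun g => α g + β g) s.2
  set b : ℕ × ℕ → G → ℝ≥0∞ := fun s => fconvPow (willis α β) s.1
  have ha : ∀ s, ∑' g, a s g = 1 := fun s => by simp only [a, tsum_fconvPow, hμ, one_pow]
  have hb : ∀ s, ∑' g, b s g = 1 := fun s => by simp only [b, tsum_fconvPow, hμ', one_pow]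
  set w : ℕ × ℕ → ℝ≥0∞ :=
    fun s => ENNReal.ofReal (Real.exp (-(Real.log 2 * (s.1 + s.2 + 2))))
  have hw : ∑' s, w s ≤ 1 := tsum_two_inv_pow_mul.le
  have hlog : 0 ≤ Real.log 2 := Real.log_nonneg one_le_two
  set A := (entropy fun g => α g + β g).toReal
  set B := (entropy (willis α β)).toReal
  have hA : 0 ≤ A := ENNReal.toReal_nonneg
  have hB : 0 ≤ B := ENNReal.toReal_nonneg
  have hcost : ∀ s, infoContent (w s) + entropy (a s) + entropy (b s) ≤
      ENNReal.ofReal ((Real.log 2 + A + B) * (s.1 + s.2 + 2)) := fun s => by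
    have h1 : infoContent (w s) = ENNReal.ofReal (Real.log 2 * (s.1 + s.2 + 2)) := by
      rw [infoContent, if_neg (by simp [w, Real.exp_pos])]
      simp only [w]
      rw [ENNReal.toReal_ofReal (Real.exp_pos _).le, Real.log_exp, neg_neg]
    have h2 : entropy (a s) ≤ ENNReal.ofReal (s.2 * A) := by
      refine (entropy_fconvPow_le hμ s.2).trans_eq ?_
      rw [ENNReal.ofReal_mul (Nat.cast_nonneg _), ENNReal.ofReal_natCast,
        ENNReal.ofReal_toReal hent]
    have h3 : entropy (b s) ≤ ENNReal.ofReal (s.1 * B) := by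
      refine (entropy_fconvPow_le hμ' s.1).trans_eq ?_
      rw [ENNReal.ofReal_mul (Nat.cast_nonneg _), ENNReal.ofReal_natCast,
        ENNReal.ofReal_toReal hent']
    rw [h1]
    refine (add_le_add (add_le_add le_rfl h2) h3).trans ?_
    rw [← ENNReal.ofReal_add (by positivity) (by positivity),
      ← ENNReal.ofReal_add (by positivity) (by positivity)]
    apply ENNReal.ofReal_le_ofReal
    have e1 : 0 ≤ A * (s.1 + 2) := by positivity
    have e2 : 0 ≤ B * (s.2 + 2) := by positivity
    linarith
  refine ⟨Real.log 2 + A + B, by positivity, fun N n δ hδ => ?_⟩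
  have hbound := stopExpect_le hp hp1 hα hβ (by positivity) hδ hcost N n
  have hf : ∑' g, fconvPow (fun g => α g + β g) N g = 1 := by rw [tsum_fconvPow, hμ, one_pow]
  have hf' : ∑' g, fconvPow (willis α β) n g = 1 := by rw [tsum_fconvPow, hμ', one_pow]
  have hE := fun φ => stopExpect_pairing_fconvPow α β φ N n
  have hE' := fun φ => stopExpect_pairing_fconvPow_willis α β φ N n
  have h1 := entropy_le_add_expectation (stopExpect_mono α β N n) (stopExpect_add α β N n)
    ha hb hw hf hf' hE hE'
  have h2 := entropy_le_add_expectation (stopExpect_mono α β N n) (stopExpect_add α β N n)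
    hb ha hw hf' hf hE' hE
  simp only [add_right_comm _ (entropy (b _))] at h2
  have hR : 0 ≤ (Real.log 2 + A + B) * ((δ + ((n - p * N) ^ 2 + N) / δ) / (2 * p) + 2) := by
    positivity
  have toReal_le : ∀ {u v : ℝ≥0∞}, v ≠ ⊤ →
      u ≤ v + ENNReal.ofReal
        ((Real.log 2 + A + B) * ((δ + ((n - p * N) ^ 2 + N) / δ) / (2 * p) + 2)) →
      u.toReal ≤ v.toReal +
        (Real.log 2 + A + B) * ((δ + ((n - p * N) ^ 2 + N) / δ) / (2 * p) + 2) := by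
    intro u v hv h
    have := ENNReal.toReal_mono (ENNReal.add_ne_top.2 ⟨hv, ENNReal.ofReal_ne_top⟩) h
    rwa [ENNReal.toReal_add hv ENNReal.ofReal_ne_top, ENNReal.toReal_ofReal hR] at this
  have g1 := toReal_le (entropy_fconvPow_ne_top hμ hent N) (h1.trans (add_le_add le_rfl hbound))
  have g2 := toReal_le (entropy_fconvPow_ne_top hμ' hent' n) (h2.trans (add_le_add le_rfl hbound))
  rw [abs_le]
  constructor <;> linarith

/-- If `μ = α + β` with `0 < ‖β‖ ≤ 1` and `μ' = β + ∑_{i ≥ 1} α^{*i} * β`, then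
`h(μ') = h(μ) / ‖β‖`. -/
theorem asymptotic_entropy_willis
    {G : Type*} [Group G] [Countable G]
    (μf α β : G → ℝ≥0∞) (hprob : ∑' g : G, μf g = 1)
    (hsplit : ∀ g : G, μf g = α g + β g)
    (hβpos : 0 < ∑' g : G, β g) (hβle : ∑' g : G, β g ≤ 1)
    (hent : Summable fun g : G => (μf g).toReal * Real.log (μf g).toReal) :
    ∃ h : ℝ,
      Tendsto (fun n : ℕ => fent (fconvPow μf n) / (n : ℝ)) atTop (𝓝 h) ∧
      Tendsto (fun n : ℕ =>
          fent (fconvPow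
            (fun g : G => β g + ∑' i : ℕ, fconv (fconvPow α (i + 1)) β g) n) / (n : ℝ))
        atTop (𝓝 (h / (∑' g : G, β g).toReal)) := by
  obtain rfl : μf = fun g => α g + β g := funext hsplit
  change ∃ h : ℝ, _ ∧ Tendsto (fun n : ℕ => fent (fconvPow (willis α β) n) / (n : ℝ)) atTop _
  have hsum : ∑' g, α g + ∑' g, β g = 1 := by rw [← ENNReal.tsum_add, hprob]
  have hβt : ∑' g, β g ≠ ⊤ := ne_top_of_le_ne_top one_ne_top hβle
  have hH := entropy_ne_top_of_summable hprob.le hent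
  set p := (∑' g, β g).toReal
  have hp : 0 < p := ENNReal.toReal_pos hβpos.ne' hβt
  have hp1 : p ≤ 1 := ENNReal.toReal_le_of_le_ofReal zero_le_one (by simpa)
  have hβ : ∑' g, β g = ENNReal.ofReal p := (ENNReal.ofReal_toReal hβt).symm
  have hα : ∑' g, α g = ENNReal.ofReal (1 - p) := by
    rw [ENNReal.ofReal_sub _ hp.le, ← hβ, ENNReal.ofReal_one, ← hsum,
      ENNReal.add_sub_cancel_right hβt]
  have hfent : ∀ n, fent (fconvPow (fun g => α g + β g) n) =
      (entropy (fconvPow (fun g => α g + β g) n)).toReal := fun n =>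
    fent_eq_toReal_entropy (by rw [tsum_fconvPow, hprob, one_pow])
  have hfent' : ∀ n, fent (fconvPow (willis α β) n) =
      (entropy (fconvPow (willis α β) n)).toReal := fun n =>
    fent_eq_toReal_entropy (by rw [tsum_fconvPow, tsum_willis hsum hβpos.ne', one_pow])
  simp only [hfent, hfent']
  obtain ⟨h, hh⟩ := exists_tendsto_entropy_fconvPow hprob hH
  refine ⟨h, hh, ?_⟩
  obtain ⟨C, hC, hCle⟩ := exists_abs_entropy_sub_le hp hp1 hα hβ hH
  set N : ℕ → ℕ := fun n => ⌊p⁻¹ * n⌋₊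
  have hNdiv : Tendsto (fun n => (N n : ℝ) / n) atTop (𝓝 p⁻¹) :=
    (tendsto_nat_floor_mul_div_atTop (inv_nonneg.2 hp.le)).comp tendsto_natCast_atTop_atTop
  have hN : Tendsto N atTop atTop := tendsto_nat_floor_atTop.comp
    (tendsto_natCast_atTop_atTop.const_mul_atTop (inv_pos.2 hp))
  have hmain : Tendsto (fun n => (entropy (fconvPow (fun g => α g + β g) (N n))).toReal / n)
      atTop (𝓝 (h / p)) := by
    rw [div_eq_mul_inv]
    refine ((hh.comp hN).mul hNdiv).congr' ?_
    filter_upwards [hN.eventually_gt_atTop 0] with n hn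
    have : (N n : ℝ) ≠ 0 := by positivity
    simp only [Function.comp]
    field_simp
  have hsqrt : Tendsto (fun n : ℕ => √(n : ℝ)) atTop atTop :=
    Real.tendsto_sqrt_atTop.comp tendsto_natCast_atTop_atTop
  set R : ℕ → ℝ := fun n =>
    C * ((1 / √(n : ℝ) + (1 / n + (N n : ℝ) / n) * (1 / √(n : ℝ))) / (2 * p) + 2 * (1 / n))
  have hinv : Tendsto (fun n : ℕ => 1 / √(n : ℝ)) atTop (𝓝 0) := by
    simp only [one_div]
    exact hsqrt.inv_tendsto_atTop
  have hR : Tendsto R atTop (𝓝 0) := by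
    have h1 : Tendsto (fun n : ℕ => 1 / (n : ℝ)) atTop (𝓝 0) := tendsto_one_div_atTop_nhds_zero_nat
    simpa [R] using (((hinv.add ((h1.add hNdiv).mul hinv)).div_const (2 * p)).add
      (h1.const_mul 2)).const_mul C
  have hdiff : Tendsto (fun n : ℕ => (entropy (fconvPow (willis α β) n)).toReal / n -
      (entropy (fconvPow (fun g => α g + β g) (N n))).toReal / n) atTop (𝓝 0) := by
    refine squeeze_zero_norm' ?_ hR
    filter_upwards [eventually_gt_atTop 0] with n hn
    have hn' : (0 : ℝ) < n := by positivity
    rw [← sub_div, Real.norm_eq_abs, abs_div, abs_of_pos hn', div_le_iff₀ hn']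
    refine (hCle (N n) n (√n) (Real.sqrt_pos.2 hn')).trans ?_
    have hsq : (n - p * N n) ^ 2 ≤ 1 := by
      have e1 : (N n : ℝ) ≤ p⁻¹ * n := Nat.floor_le (by positivity)
      have e2 : p⁻¹ * n < N n + 1 := Nat.lt_floor_add_one _
      have e3 := mul_le_mul_of_nonneg_left e1 hp.le
      have e4 := mul_lt_mul_of_pos_left e2 hp
      rw [mul_inv_cancel_left₀ hp.ne'] at e3 e4
      rw [sq_le_one_iff₀ (by linarith)]
      linarith
    calc C * ((√n + ((n - p * N n) ^ 2 + N n) / √n) / (2 * p) + 2)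
        ≤ C * ((√n + (1 + N n) / √n) / (2 * p) + 2) := by gcongr
      _ = R n * n := by
        have hs := Real.sqrt_pos.2 hn'
        have hs2 : (n : ℝ) = √n ^ 2 := (Real.sq_sqrt hn'.le).symm
        simp only [R]
        generalize √(n : ℝ) = t at *
        rw [hs2]
        field_simp
  simpa using hdiff.add hmain
end

section
/- Let G be a countable group and μ a probability measure on G with finite entropy H(μ). On the path space (G^{ℤ₊}, P) of the random walk (G,μ), define Mₙ(x) = n·H(μ) + log μ^{*n}(xₙ). Then each Mₙ is integrable and the sequence (Mₙ) is a submartingale with respect to the filtration (𝒜₀ⁿ) generated by the positions of the random walk, i.e., E(M_{n+1} | 𝒜₀ⁿ) ≥ Mₙ P-almost surely for every n. -/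
open MeasureTheory Filter Real Topology ENNReal

/-- The σ-algebra `𝒜₀ˢ` generated by the positions `x 0, …, x s` of the random walk. -/
def posSigma (G : Type*) [Group G] [MeasurableSpace G] (s : ℕ) :
    MeasurableSpace (ℕ → G) :=
  MeasurableSpace.comap (fun ω (i : Fin (s + 1)) => rwPos ω (i : ℕ)) inferInstance

/-- A Markov stopping time for the random walk: for every `s`, the set `{τ = s}` is measurable
with respect to the σ-algebra generated by the positions of the walk up to time `s`. -/
def IsMST {G : Type*} [Group G] [MeasurableSpace G] (τ : (ℕ → G) → ℕ) : Prop :=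
  ∀ s : ℕ, MeasurableSet[posSigma G s] {ω | τ ω = s}

section ConvolutionPower

variable {G : Type*} [Group G] {f : G → ℝ≥0∞}

lemma rwPos_succ (h : ℕ → G) (n : ℕ) : rwPos h (n + 1) = rwPos h n * h n := by
  simp [rwPos, List.range_succ]

lemma fconvPow_le_one (hf : ∑' g : G, f g = 1) (n : ℕ) (x : G) : fconvPow f n x ≤ 1 := by
  induction n generalizing x with
  | zero => simp only [fconvPow]; split_ifs <;> simp
  | succ n ih =>
    calc fconvPow f (n + 1) x = ∑' h : G, fconvPow f n h * f (h⁻¹ * x) := rfl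
      _ ≤ ∑' h : G, f (h⁻¹ * x) := ENNReal.tsum_le_tsum fun h => mul_le_of_le_one_left' (ih h)
      _ = 1 := by rw [← hf]; exact ((Equiv.inv G).trans (Equiv.mulRight x)).tsum_eq f

lemma mul_le_fconvPow_succ (n : ℕ) (x h : G) :
    fconvPow f n x * f h ≤ fconvPow f (n + 1) (x * h) := by
  simpa [fconvPow, fconv] using
    ENNReal.le_tsum (f := fun g : G => fconvPow f n g * f (g⁻¹ * (x * h))) x

lemma fconvPow_rwPos_ne_zero {ω : ℕ → G} (hω : ∀ i, f (ω i) ≠ 0) (n : ℕ) :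
    fconvPow f n (rwPos ω n) ≠ 0 := by
  induction n with
  | zero => simp [fconvPow, rwPos]
  | succ n ih =>
    rw [rwPos_succ]
    exact ((pos_iff_ne_zero.2 (mul_ne_zero ih (hω n))).trans_le (mul_le_fconvPow_succ _ _ _)).ne'

lemma log_fconvPow_add_le (hf : ∑' g : G, f g = 1) {ω : ℕ → G} (hω : ∀ i, f (ω i) ≠ 0) (n : ℕ) :
    Real.log (fconvPow f n (rwPos ω n)).toReal + Real.log (f (ω n)).toReal
      ≤ Real.log (fconvPow f (n + 1) (rwPos ω (n + 1))).toReal := by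
  have htop (k : ℕ) (x : G) : fconvPow f k x ≠ ∞ :=
    ((fconvPow_le_one hf k x).trans_lt one_lt_top).ne
  have hftop : f (ω n) ≠ ∞ := ((ENNReal.le_tsum (ω n)).trans_lt (hf ▸ one_lt_top)).ne
  have hn := ENNReal.toReal_pos (fconvPow_rwPos_ne_zero hω n) (htop n _)
  have hs := ENNReal.toReal_pos (hω n) hftop
  rw [← Real.log_mul hn.ne' hs.ne', rwPos_succ, ← ENNReal.toReal_mul]
  refine Real.log_le_log (by rw [ENNReal.toReal_mul]; positivity) ?_
  exact ENNReal.toReal_mono (htop _ _) (mul_le_fconvPow_succ _ _ _)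

lemma log_fconvPow_nonpos (hf : ∑' g : G, f g = 1) (n : ℕ) (x : G) :
    Real.log (fconvPow f n x).toReal ≤ 0 :=
  Real.log_nonpos ENNReal.toReal_nonneg
    (ENNReal.toReal_le_of_le_ofReal zero_le_one (by simpa using fconvPow_le_one hf n x))

end ConvolutionPower

section DiscreteDensity

variable {G : Type*} [Countable G] [MeasurableSpace G] [DiscreteMeasurableSpace G] {f : G → ℝ≥0∞}

lemma count_withDensity_singleton (a : G) : (Measure.count.withDensity f) {a} = f a := by
  rw [withDensity_apply _ (measurableSet_singleton a)]
  simp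

lemma isProbabilityMeasure_count_withDensity (hf : ∑' g : G, f g = 1) :
    IsProbabilityMeasure (Measure.count.withDensity f) :=
  ⟨by rw [withDensity_apply _ MeasurableSet.univ, Measure.restrict_univ, lintegral_count, hf]⟩

lemma integrable_log_count_withDensity (hf : ∑' g : G, f g = 1)
    (hent : Summable fun g : G => (f g).toReal * Real.log (f g).toReal) :
    Integrable (fun g => Real.log (f g).toReal) (Measure.count.withDensity f) := by
  have htop (g : G) : f g < ∞ := (ENNReal.le_tsum g).trans_lt (hf ▸ one_lt_top)
  rw [integrable_withDensity_iff_integrable_smul' (measurable_of_countable f)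
    (Eventually.of_forall htop), integrable_count_iff]
  simpa using hent.norm

lemma integral_log_count_withDensity (hf : ∑' g : G, f g = 1)
    (hent : Summable fun g : G => (f g).toReal * Real.log (f g).toReal) :
    ∫ g, Real.log (f g).toReal ∂(Measure.count.withDensity f) = -fent f := by
  have htop (g : G) : f g < ∞ := (ENNReal.le_tsum g).trans_lt (hf ▸ one_lt_top)
  rw [integral_withDensity_eq_integral_toReal_smul (measurable_of_countable f)
    (Eventually.of_forall htop), integral_countable (integrable_count_iff.2 (by simpa using hent.norm))]
  simp [fent, Measure.real]

end DiscreteDensity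

section Increments

lemma measurable_initialIncrements {G : Type*} [MeasurableSpace G] (n : ℕ) :
    Measurable (fun (ω : ℕ → G) (i : Fin n) => ω i) :=
  measurable_pi_lambda _ fun i => measurable_pi_apply (i : ℕ)

variable {G : Type*} [Countable G] [MeasurableSpace G] [DiscreteMeasurableSpace G]
  {f : G → ℝ≥0∞} {P : Measure (ℕ → G)}

lemma map_initialIncrements_prod (hf : ∑' g : G, f g = 1)
    (hP : ∀ (n : ℕ) (g : ℕ → G),
      P {ω | ∀ i < n, ω i = g i} = ∏ i ∈ Finset.range n, f (g i)) (n : ℕ) :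
    P.map (fun ω => ((fun i : Fin n => ω i), ω n))
      = (P.map fun ω (i : Fin n) => ω i).prod (Measure.count.withDensity f) := by
  have := isProbabilityMeasure_count_withDensity hf
  refine Measure.ext_of_singleton fun ⟨v, a⟩ => ?_
  let g : ℕ → G := fun i => if h : i < n then v ⟨i, h⟩ else a
  have hpair : (fun ω : ℕ → G => ((fun i : Fin n => ω i), ω n)) ⁻¹' {(v, a)}
      = {ω | ∀ i < n + 1, ω i = g i} := by
    ext ω
    simp only [Set.mem_preimage, Set.mem_singleton_iff, Prod.mk.injEq, Set.mem_ofPred_eq,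
      Nat.forall_lt_succ_right, funext_iff, Fin.forall_iff]
    refine and_congr (forall₂_congr fun i hi => by simp [g, hi]) (by simp [g])
  have hfst : (fun (ω : ℕ → G) (i : Fin n) => ω i) ⁻¹' {v} = {ω | ∀ i < n, ω i = g i} := by
    ext ω
    simp only [Set.mem_preimage, Set.mem_singleton_iff, Set.mem_ofPred_eq, funext_iff,
      Fin.forall_iff]
    exact forall₂_congr fun i hi => by simp [g, hi]
  rw [← Set.singleton_prod_singleton, Measure.prod_prod, count_withDensity_singleton,
    Measure.map_apply (measurable_initialIncrements n) (measurableSet_singleton v), hfst,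
    Set.singleton_prod_singleton, Measure.map_apply
      ((measurable_initialIncrements n).prodMk (measurable_pi_apply n))
      (measurableSet_singleton _), hpair, hP, hP, Finset.prod_range_succ]
  simp [g]

variable [IsProbabilityMeasure P]

lemma map_increment (hf : ∑' g : G, f g = 1)
    (hP : ∀ (n : ℕ) (g : ℕ → G),
      P {ω | ∀ i < n, ω i = g i} = ∏ i ∈ Finset.range n, f (g i)) (n : ℕ) :
    P.map (fun ω => ω n) = Measure.count.withDensity f := by
  have := isProbabilityMeasure_count_withDensity hf
  have := Measure.isProbabilityMeasure_map (μ := P) (measurable_initialIncrements n).aemeasurable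
  have h := congrArg (Measure.map Prod.snd) (map_initialIncrements_prod hf hP n)
  rw [Measure.map_map measurable_snd
    ((measurable_initialIncrements n).prodMk (measurable_pi_apply n)), Measure.map_snd_prod,
    measure_univ, one_smul] at h
  exact h

lemma indepFun_increment_initialIncrements (hf : ∑' g : G, f g = 1)
    (hP : ∀ (n : ℕ) (g : ℕ → G),
      P {ω | ∀ i < n, ω i = g i} = ∏ i ∈ Finset.range n, f (g i)) (n : ℕ) :
    ProbabilityTheory.IndepFun (fun ω => ω n) (fun ω (i : Fin n) => ω i) P := by
  refine ProbabilityTheory.IndepFun.symm ?_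
  rw [ProbabilityTheory.indepFun_iff_map_prod_eq_prod_map_map
    (measurable_initialIncrements n).aemeasurable (measurable_pi_apply n).aemeasurable,
    map_initialIncrements_prod hf hP, map_increment hf hP]

lemma ae_increment_ne_zero (hf : ∑' g : G, f g = 1)
    (hP : ∀ (n : ℕ) (g : ℕ → G),
      P {ω | ∀ i < n, ω i = g i} = ∏ i ∈ Finset.range n, f (g i)) :
    ∀ᵐ ω ∂P, ∀ i, f (ω i) ≠ 0 := by
  refine ae_all_iff.2 fun i => ae_of_ae_map (f := fun ω : ℕ → G => ω i)
    (p := fun g => f g ≠ 0) (measurable_pi_apply i).aemeasurable ?_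
  rw [map_increment hf hP, ae_withDensity_iff (measurable_of_countable f)]
  exact Eventually.of_forall fun _ h => h

lemma integrable_log_increment (hf : ∑' g : G, f g = 1)
    (hent : Summable fun g : G => (f g).toReal * Real.log (f g).toReal)
    (hP : ∀ (n : ℕ) (g : ℕ → G),
      P {ω | ∀ i < n, ω i = g i} = ∏ i ∈ Finset.range n, f (g i)) (n : ℕ) :
    Integrable (fun ω => Real.log (f (ω n)).toReal) P := by
  have h := integrable_log_count_withDensity hf hent
  rw [← map_increment hf hP n] at h
  exact h.comp_measurable (measurable_pi_apply n)

lemma integral_log_increment (hf : ∑' g : G, f g = 1)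
    (hent : Summable fun g : G => (f g).toReal * Real.log (f g).toReal)
    (hP : ∀ (n : ℕ) (g : ℕ → G),
      P {ω | ∀ i < n, ω i = g i} = ∏ i ∈ Finset.range n, f (g i)) (n : ℕ) :
    ∫ ω, Real.log (f (ω n)).toReal ∂P = -fent f := by
  rw [← integral_log_count_withDensity hf hent, ← map_increment hf hP n,
    integral_map (measurable_pi_apply n).aemeasurable
      (measurable_of_countable _).aestronglyMeasurable]

end Increments

section RandomWalk

variable {G : Type*} [Group G] [Countable G] [MeasurableSpace G] [DiscreteMeasurableSpace G]
  {f : G → ℝ≥0∞} {P : Measure (ℕ → G)} [IsProbabilityMeasure P]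

lemma measurable_rwPos (n : ℕ) : Measurable (fun ω : ℕ → G => rwPos ω n) := by
  induction n with
  | zero => exact measurable_const
  | succ n ih =>
    simp only [rwPos_succ]
    exact (measurable_of_countable fun p : G × G => p.1 * p.2).comp
      (ih.prodMk (measurable_pi_apply n))

lemma posSigma_le (n : ℕ) : posSigma G n ≤ MeasurableSpace.pi :=
  (measurable_pi_lambda _ fun i : Fin (n + 1) => measurable_rwPos (G := G) (i : ℕ)).comap_le

lemma posSigma_le_comap_initialIncrements (n : ℕ) :
    posSigma G n ≤
      MeasurableSpace.comap (fun (ω : ℕ → G) (i : Fin n) => ω i) MeasurableSpace.pi := by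
  let F : (Fin n → G) → Fin (n + 1) → G := fun v i =>
    rwPos (fun j => if h : j < n then v ⟨j, h⟩ else 1) i
  have hF : (fun (ω : ℕ → G) (i : Fin (n + 1)) => rwPos ω (i : ℕ))
      = F ∘ fun (ω : ℕ → G) (i : Fin n) => ω i := by
    ext ω i
    refine congrArg List.prod (List.map_congr_left fun j hj => ?_)
    have : j < n := by have := List.mem_range.1 hj; omega
    simp [this]
  rw [posSigma, hF, ← MeasurableSpace.comap_comp]
  exact MeasurableSpace.comap_mono (measurable_of_countable F).comap_le

lemma measurable_rwPos_posSigma {G : Type*} [Group G] [MeasurableSpace G] (n : ℕ) :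
    Measurable[posSigma G n] (fun ω : ℕ → G => rwPos ω n) :=
  (measurable_pi_apply (Fin.last n)).comp
    (comap_measurable fun (ω : ℕ → G) (i : Fin (n + 1)) => rwPos ω (i : ℕ))

lemma condExp_log_increment (hf : ∑' g : G, f g = 1)
    (hent : Summable fun g : G => (f g).toReal * Real.log (f g).toReal)
    (hP : ∀ (n : ℕ) (g : ℕ → G),
      P {ω | ∀ i < n, ω i = g i} = ∏ i ∈ Finset.range n, f (g i)) (n : ℕ) :
    P[(fun ω => Real.log (f (ω n)).toReal) | posSigma G n] =ᵐ[P] fun _ => -fent f := by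
  rw [← integral_log_increment hf hent hP n]
  refine condExp_indep_eq (measurable_pi_apply n).comap_le (posSigma_le n) ?_
    (ProbabilityTheory.indep_of_indep_of_le_right
      (indepFun_increment_initialIncrements hf hP n) (posSigma_le_comap_initialIncrements n))
  exact ((measurable_of_countable fun g => Real.log (f g).toReal).comp
    (comap_measurable fun ω : ℕ → G => ω n)).stronglyMeasurable

lemma integrable_log_fconvPow_rwPos (hf : ∑' g : G, f g = 1)
    (hent : Summable fun g : G => (f g).toReal * Real.log (f g).toReal)
    (hP : ∀ (n : ℕ) (g : ℕ → G),
      P {ω | ∀ i < n, ω i = g i} = ∏ i ∈ Finset.range n, f (g i)) (n : ℕ) :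
    Integrable (fun ω => Real.log (fconvPow f n (rwPos ω n)).toReal) P := by
  induction n with
  | zero => simp [fconvPow, rwPos]
  | succ n ih =>
    refine (ih.add (integrable_log_increment hf hent hP n)).mono
      ((measurable_of_countable fun g => Real.log (fconvPow f (n + 1) g).toReal).comp
        (measurable_rwPos (n + 1))).aestronglyMeasurable ?_
    filter_upwards [ae_increment_ne_zero hf hP] with ω hω
    have h := log_fconvPow_add_le hf hω n
    have h₀ := log_fconvPow_nonpos hf (n + 1) (rwPos ω (n + 1))
    simp only [Pi.add_apply, Real.norm_eq_abs]
    rw [abs_of_nonpos h₀, abs_of_nonpos (h.trans h₀)]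
    exact neg_le_neg h

end RandomWalk

/-- `M_n(x) = n H(μ) + log μ^{*n}(x_n)` is an integrable submartingale with
respect to the filtration generated by the positions of the random walk. -/
theorem log_convPow_submartingale
    {G : Type*} [Group G] [Countable G] [MeasurableSpace G] [DiscreteMeasurableSpace G]
    (μf : G → ℝ≥0∞) (hprob : ∑' g : G, μf g = 1)
    (hent : Summable fun g : G => (μf g).toReal * Real.log (μf g).toReal)
    (P : Measure (ℕ → G)) [IsProbabilityMeasure P]
    (hP : ∀ (n : ℕ) (g : ℕ → G),
      P {ω | ∀ i < n, ω i = g i} = ∏ i ∈ Finset.range n, μf (g i)) :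
    (∀ n : ℕ, Integrable
        (fun ω => (n : ℝ) * fent μf + Real.log ((fconvPow μf n (rwPos ω n)).toReal)) P) ∧
      ∀ n : ℕ,
        (fun ω => (n : ℝ) * fent μf + Real.log ((fconvPow μf n (rwPos ω n)).toReal))
          ≤ᵐ[P]
        P[(fun ω => ((n : ℝ) + 1) * fent μf
            + Real.log ((fconvPow μf (n + 1) (rwPos ω (n + 1))).toReal)) | posSigma G n] := by
  have hlog (n : ℕ) := integrable_log_fconvPow_rwPos hprob hent hP n
  refine ⟨fun n => (integrable_const _).add (hlog n), fun n => ?_⟩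
  have hM : Integrable (fun ω => ((n : ℝ) + 1) * fent μf
      + Real.log ((fconvPow μf n (rwPos ω n)).toReal)) P := (integrable_const _).add (hlog n)
  have hX := integrable_log_increment hprob hent hP n
  have hmono := condExp_mono (m := posSigma G n) (hM.add hX)
    ((integrable_const (((n : ℝ) + 1) * fent μf)).add (hlog (n + 1))) <| by
      filter_upwards [ae_increment_ne_zero hprob hP] with ω hω
      have := log_fconvPow_add_le hprob hω n
      simp only [Pi.add_apply]
      linarith
  have hmeas : StronglyMeasurable[posSigma G n] (fun ω => ((n : ℝ) + 1) * fent μf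
      + Real.log ((fconvPow μf n (rwPos ω n)).toReal)) :=
    ((measurable_of_countable fun g => ((n : ℝ) + 1) * fent μf
      + Real.log (fconvPow μf n g).toReal).comp (measurable_rwPos_posSigma n)).stronglyMeasurable
  have hadd := condExp_add hM hX (posSigma G n)
  rw [condExp_of_stronglyMeasurable (posSigma_le n) hmeas hM] at hadd
  filter_upwards [hmono, hadd, condExp_log_increment hprob hent hP n] with ω h₁ h₂ h₃
  refine le_trans (le_of_eq ?_) h₁
  rw [h₂, Pi.add_apply, h₃]
  ring
end
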